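/- arXiv:2505.02404 — 3 statements merged into one kernel-verified Lean document; each statement's English description precedes it below -/
import Mathlib

section
/- Let k₁ = 2 and 2 ≤ t ≤ min(k₂, d). Then √𝓘_C = ⋂ √(I_S), where the intersection is taken over all minimal subsets S ⊆ [2]×[k₂]; moreover, every ideal I_S appearing in this intersection is minimal among {I_{S'} : S' ⊆ [2]×[k₂]}. -/
noncomputable section

open MvPolynomial

namespace CI

/-- The column index set `[k₁] × [k₂]`. -/
abbrev Col (k₁ k₂ : ℕ) := Fin k₁ × Fin k₂

/-- The polynomial ring `ℂ[X]` in the entries of the `d × (k₁k₂)` matrix `X` of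
indeterminates `x_{i,(j,ℓ)}`. -/
abbrev MvP (d k₁ k₂ : ℕ) := MvPolynomial (Fin d × Col k₁ k₂) ℂ

/-- The `r × r` minor of `X` with rows `a` and columns `b`. -/
def minorPoly (d k₁ k₂ r : ℕ) (a : Fin r → Fin d) (b : Fin r → Col k₁ k₂) :
    MvP d k₁ k₂ :=
  (Matrix.of fun i j => (X (a i, b j) : MvP d k₁ k₂)).det

/-- `F_r(X_U)`: the set of all `r × r` minors of the submatrix `X_U`. -/
def minorSet (d k₁ k₂ r : ℕ) (U : Set (Col k₁ k₂)) : Set (MvP d k₁ k₂) :=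
  { f | ∃ a : Fin r → Fin d, ∃ b : Fin r → Col k₁ k₂,
      Function.Injective a ∧ Function.Injective b ∧ (∀ i, b i ∈ U) ∧
      f = minorPoly d k₁ k₂ r a b }

/-- `I_r(X_U)`: the ideal generated by the `r × r` minors of `X_U`. -/
def minorIdeal (d k₁ k₂ r : ℕ) (U : Set (Col k₁ k₂)) : Ideal (MvP d k₁ k₂) :=
  Ideal.span (minorSet d k₁ k₂ r U)

/-- The row slice `R_i = {i} × [k₂]`. -/
def rowSlice (k₁ k₂ : ℕ) (i : Fin k₁) : Set (Col k₁ k₂) := { p | p.1 = i }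

/-- The column slice `C_j = [k₁] × {j}`. -/
def colSlice (k₁ k₂ : ℕ) (j : Fin k₂) : Set (Col k₁ k₂) := { p | p.2 = j }

/-- The conditional independence ideal `𝓘_C = Σ_j I_2(X_{C_j}) + Σ_i I_t(X_{R_i})`. -/
def ciIdeal (d k₁ k₂ t : ℕ) : Ideal (MvP d k₁ k₂) :=
  (⨆ j : Fin k₂, minorIdeal d k₁ k₂ 2 (colSlice k₁ k₂ j)) ⊔
    ⨆ i : Fin k₁, minorIdeal d k₁ k₂ t (rowSlice k₁ k₂ i)

/-- `I_∅ = I_t(X) + Σ_j I_2(X_{C_j})`. -/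
def Iempty (d k₁ k₂ t : ℕ) : Ideal (MvP d k₁ k₂) :=
  minorIdeal d k₁ k₂ t Set.univ ⊔
    ⨆ j : Fin k₂, minorIdeal d k₁ k₂ 2 (colSlice k₁ k₂ j)

/-! ### The case `k₁ = 2`: the ideals `I_S` -/

/-- The column slice `C_j` does not meet `S`. -/
def colOK (k₂ : ℕ) (S : Set (Col 2 k₂)) (j : Fin k₂) : Prop := ∀ i : Fin 2, (i, j) ∉ S

/-- `𝒞(S)`: the union of all column slices not meeting `S`. -/
def CSet (k₂ : ℕ) (S : Set (Col 2 k₂)) : Set (Col 2 k₂) := { p | colOK k₂ S p.2 }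

/-- The condition `Z(1,S) ∖ Z(2,S) ≠ ∅` and `Z(2,S) ∖ Z(1,S) ≠ ∅` under which the
`(t-1)`-minors are included in `F_S`. -/
def tCond (k₂ : ℕ) (S : Set (Col 2 k₂)) : Prop :=
  (∃ ℓ, ((0 : Fin 2), ℓ) ∈ S ∧ ((1 : Fin 2), ℓ) ∉ S) ∧
  (∃ ℓ, ((1 : Fin 2), ℓ) ∈ S ∧ ((0 : Fin 2), ℓ) ∉ S)

/-- The generating set `F_S` of the ideal `I_S` (for `k₁ = 2`). -/
def FSset (d k₂ t : ℕ) (S : Set (Col 2 k₂)) : Set (MvP d 2 k₂) :=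
  minorSet d 2 k₂ 1 S ∪
  (⋃ j ∈ { j : Fin k₂ | colOK k₂ S j }, minorSet d 2 k₂ 2 (colSlice 2 k₂ j)) ∪
  (⋃ _ : tCond k₂ S, minorSet d 2 k₂ (t - 1) (CSet k₂ S)) ∪
  minorSet d 2 k₂ t ((rowSlice 2 k₂ 0 \ S) ∪ CSet k₂ S) ∪
  minorSet d 2 k₂ t ((rowSlice 2 k₂ 1 \ S) ∪ CSet k₂ S)

/-- The ideal `I_S ⊆ ℂ[X]` for `S ⊆ [2] × [k₂]`, generated by `F_S`. -/
def ISIdeal (d k₂ t : ℕ) (S : Set (Col 2 k₂)) : Ideal (MvP d 2 k₂) :=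
  Ideal.span (FSset d k₂ t S)

/-- `u = min(|R₁ ∩ S|, |R₂ ∩ S|)`, the first entry of the combinatorial type of `S`. -/
def uOf (k₂ : ℕ) (S : Set (Col 2 k₂)) : ℕ :=
  min ((rowSlice 2 k₂ 0 ∩ S).ncard) ((rowSlice 2 k₂ 1 ∩ S).ncard)

/-- `v = max(|R₁ ∩ S|, |R₂ ∩ S|)`, the second entry of the combinatorial type of `S`. -/
def vOf (k₂ : ℕ) (S : Set (Col 2 k₂)) : ℕ :=
  max ((rowSlice 2 k₂ 0 ∩ S).ncard) ((rowSlice 2 k₂ 1 ∩ S).ncard)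

/-- `S` contains no column slice. -/
def noColumn (k₂ : ℕ) (S : Set (Col 2 k₂)) : Prop :=
  ∀ j : Fin k₂, ¬ colSlice 2 k₂ j ⊆ S

/-- A subset `S ⊆ [2] × [k₂]` is minimal: `S = ∅`, or `S` contains no column slice,
its combinatorial type `(u,v)` satisfies `1 ≤ u ≤ v ≤ k₂ - t + 1`, and `u + v = k₂`
in case `t = 2`. -/
def minimalSubset (k₂ t : ℕ) (S : Set (Col 2 k₂)) : Prop :=
  S = ∅ ∨ (noColumn k₂ S ∧ 1 ≤ uOf k₂ S ∧ uOf k₂ S ≤ vOf k₂ S ∧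
    vOf k₂ S ≤ k₂ - t + 1 ∧ (t = 2 → uOf k₂ S + vOf k₂ S = k₂))

/-! ### Hypergraphs and their closure -/

/-- The hypergraph `H(S)` on `[k₁] × [k₂]`: its hyperedges are (1) the singletons of
elements of `S`; (2) the 2-subsets of a column slice disjoint from `S`; (3) the
`(t-1)`-subsets of `{i,j} × (NZ(i,S) ∩ NZ(j,S))` for distinct rows `i, j` with
`Z(i,S) ∖ Z(j,S) ≠ ∅` and `Z(j,S) ∖ Z(i,S) ≠ ∅`; (4) the `t`-subsets of a row slice
disjoint from `S`. -/
def HS (k₁ k₂ t : ℕ) (S : Set (Col k₁ k₂)) : Set (Finset (Col k₁ k₂)) :=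
  { e | (∃ p ∈ S, e = {p})
      ∨ (e.card = 2 ∧ (∃ j, ∀ p ∈ e, p.2 = j) ∧ ∀ p ∈ e, p ∉ S)
      ∨ (e.card = t - 1 ∧ ∃ i j : Fin k₁, i ≠ j ∧
           (∃ ℓ, (i, ℓ) ∈ S ∧ (j, ℓ) ∉ S) ∧ (∃ ℓ, (j, ℓ) ∈ S ∧ (i, ℓ) ∉ S) ∧
           ∀ p ∈ e, (p.1 = i ∨ p.1 = j) ∧ (i, p.2) ∉ S ∧ (j, p.2) ∉ S)
      ∨ (e.card = t ∧ (∃ i, ∀ p ∈ e, p.1 = i) ∧ ∀ p ∈ e, p ∉ S) }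

/-- The closure of a hypergraph: iterate the rule "if `{a,b}` and `e` (with `a ∈ e`)
are hyperedges, then add `(e ∖ {a}) ∪ {b}`". -/
inductive HClosure {k₁ k₂ : ℕ} (H : Set (Finset (Col k₁ k₂))) :
    Finset (Col k₁ k₂) → Prop
  | base {e : Finset (Col k₁ k₂)} : e ∈ H → HClosure H e
  | step {e : Finset (Col k₁ k₂)} (a b : Col k₁ k₂) :
      a ∈ e → HClosure H {a, b} → HClosure H e → HClosure H (insert b (e.erase a))

/-- The determinantal ideal of a hypergraph: it is generated by the minors `[A|B]`
with `A ⊆ [d]`, `B` a hyperedge, and `|A| = |B|`. -/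
def hypIdeal (d k₁ k₂ : ℕ) (H : Set (Finset (Col k₁ k₂))) : Ideal (MvP d k₁ k₂) :=
  Ideal.span { f | ∃ e ∈ H, ∃ a : Fin e.card → Fin d, ∃ b : Fin e.card → Col k₁ k₂,
      Function.Injective a ∧ Function.Injective b ∧ (∀ i, b i ∈ e) ∧
      f = minorPoly d k₁ k₂ e.card a b }

/-- The ideal `I_S` associated to the closure of the hypergraph `H(S)`. -/
def ISclosure (d k₁ k₂ t : ℕ) (S : Set (Col k₁ k₂)) : Ideal (MvP d k₁ k₂) :=
  hypIdeal d k₁ k₂ { e | HClosure (HS k₁ k₂ t S) e }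

/-! ### The lexicographic monomial order -/

/-- `varLT a b` means the variable `x_a` is *larger* than `x_b` in the variable order
`x_{1,(1,1)} > x_{2,(1,1)} > ⋯ > x_{d,(1,1)} > x_{1,(2,1)} > ⋯ > x_{d,(k₁,k₂)}`,
i.e. `(ℓ, j, i)` precedes `(ℓ', j', i')` lexicographically, where `a = (i, (j, ℓ))`. -/
def varLT (d k₁ k₂ : ℕ) (a b : Fin d × Col k₁ k₂) : Prop :=
  Prod.Lex (· < ·) (Prod.Lex (· < ·) (· < ·))
    (a.2.2, (a.2.1, a.1)) (b.2.2, (b.2.1, b.1))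

/-- `m ≺ m'` in the lexicographic monomial order determined by the variable order:
at the largest variable where the exponents differ, `m` has the smaller exponent. -/
def monLT (d k₁ k₂ : ℕ) (m m' : (Fin d × Col k₁ k₂) →₀ ℕ) : Prop :=
  ∃ v, (∀ w, varLT d k₁ k₂ w v → m w = m' w) ∧ m v < m' v

/-- `m` is the `≺`-leading monomial of `f`. -/
def IsLeadMon (d k₁ k₂ : ℕ) (f : MvP d k₁ k₂) (m : (Fin d × Col k₁ k₂) →₀ ℕ) : Prop :=
  m ∈ f.support ∧ ∀ m' ∈ f.support, m' = m ∨ monLT d k₁ k₂ m' m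

/-- `G` is a Gröbner basis of `I` with respect to the lexicographic order `≺`:
`G` is contained in `I` and for every nonzero `f ∈ I` there is a `g ∈ G` whose
`≺`-leading monomial divides the `≺`-leading monomial of `f`. -/
def IsGB (d k₁ k₂ : ℕ) (G : Set (MvP d k₁ k₂)) (I : Ideal (MvP d k₁ k₂)) : Prop :=
  G ⊆ (I : Set (MvP d k₁ k₂)) ∧ ∀ f ∈ I, f ≠ 0 →
    ∃ g ∈ G, ∃ mg, IsLeadMon d k₁ k₂ g mg ∧
      ∀ mf, IsLeadMon d k₁ k₂ f mf → ∀ x, mg x ≤ mf x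

/-! ### The matrix `D_A` -/

/-- For `A ∈ ℂ^{k₂ × (k₁-1)}`, the `k₂ × (k₁k₂)` matrix `D_A`: its row `r` has entry
`1` in the column indexed by `(1, r)`, entry `A r ℓ` in the column indexed by
`(1+ℓ, r)` for `ℓ ∈ [k₁-1]`, and zeros elsewhere. -/
def DMat (k₁ k₂ : ℕ) (A : Matrix (Fin k₂) (Fin (k₁ - 1)) ℂ) :
    Matrix (Fin k₂) (Col k₁ k₂) ℂ := fun r c =>
  if c.2 = r then
    (if _h : (c.1 : ℕ) = 0 then 1
     else A r ⟨(c.1 : ℕ) - 1, by have := c.1.isLt; omega⟩)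
  else 0

end CI

namespace CI

open Module Submodule

/-- A family spanning a space of dimension at least `r` has `r` independent members. -/
theorem exists_linearIndependent_fin {V ι : Type*} [AddCommGroup V] [Module ℂ V]
    [FiniteDimensional ℂ V] (v : ι → V) {r : ℕ}
    (hr : r ≤ finrank ℂ (span ℂ (Set.range v))) :
    ∃ b : Fin r → ι, Function.Injective b ∧ LinearIndependent ℂ (v ∘ b) := by
  obtain ⟨κ, a, ha, hsp, hli⟩ := exists_linearIndependent' ℂ v
  have : Finite κ := hli.finite
  have : Fintype κ := Fintype.ofFinite κ
  rw [← hsp, finrank_span_eq_card hli] at hr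
  obtain ⟨f⟩ : Nonempty (Fin r ↪ κ) := Function.Embedding.nonempty_of_card_le (by simpa using hr)
  exact ⟨a ∘ f, ha.comp f.injective, hli.comp f f.injective⟩

/-- The dimension of the span of the vectors `v p`, `p ∈ U`. -/
def rk {V ι : Type*} [AddCommGroup V] [Module ℂ V] (v : ι → V) (U : Set ι) : ℕ :=
  finrank ℂ (span ℂ (v '' U))

theorem rk_lt_iff_minors {ι : Type*} {d : ℕ} (v : ι → Fin d → ℂ) (U : Set ι) (r : ℕ) :
    rk v U < r ↔ ∀ (a : Fin r → Fin d) (b : Fin r → ι), Function.Injective a →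
      Function.Injective b → (∀ i, b i ∈ U) →
      (Matrix.of fun i j => v (b j) (a i)).det = 0 := by
  constructor
  · intro h a b _ _ hbU
    by_contra hdet
    have hli : LinearIndependent ℂ (Matrix.of fun i j => v (b j) (a i)).col :=
      Matrix.linearIndependent_cols_iff_isUnit.2
        ((Matrix.isUnit_iff_isUnit_det _).2 (isUnit_iff_ne_zero.2 hdet))
    have hli' : LinearIndependent ℂ (v ∘ b) :=
      LinearIndependent.of_comp (LinearMap.funLeft ℂ ℂ a) hli
    have hle : finrank ℂ (span ℂ (Set.range (v ∘ b))) ≤ rk v U :=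
      finrank_mono (span_mono (by rintro _ ⟨i, rfl⟩; exact ⟨b i, hbU i, rfl⟩))
    rw [finrank_span_eq_card hli', Fintype.card_fin] at hle
    omega
  · intro h
    by_contra! hr
    rw [rk, Set.image_eq_range] at hr
    obtain ⟨b, hb, hli⟩ := exists_linearIndependent_fin (fun p : U => v p) hr
    let M : Matrix (Fin d) (Fin r) ℂ := Matrix.of fun i j => v (b j) i
    have hM : M.rank = r := by
      rw [Matrix.rank_eq_finrank_span_cols]
      exact (finrank_span_eq_card hli).trans (Fintype.card_fin r)
    rw [Matrix.rank_eq_finrank_span_row] at hM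
    obtain ⟨a, ha, hli'⟩ := exists_linearIndependent_fin M.row hM.ge
    have hu : IsUnit (Matrix.of fun i j => v (b j) (a i)) :=
      Matrix.linearIndependent_rows_iff_isUnit.1 hli'
    exact ((Matrix.isUnit_iff_isUnit_det _).1 hu).ne_zero
      (h a (fun j => b j) ha (Subtype.val_injective.comp hb) fun i => (b i).2)

section rank

variable {V ι κ : Type*} [AddCommGroup V] [Module ℂ V] [FiniteDimensional ℂ V] {v : ι → V}

theorem rk_le_of_image_subset {U W : Set ι} (h : ∀ p ∈ U, v p ∈ span ℂ (v '' W)) :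
    rk v U ≤ rk v W :=
  finrank_mono (span_le.2 (by rintro _ ⟨p, hp, rfl⟩; exact h p hp))

theorem rk_mono {U W : Set ι} (h : U ⊆ W) : rk v U ≤ rk v W :=
  rk_le_of_image_subset fun p hp => subset_span ⟨p, h hp, rfl⟩

theorem rk_le_ncard (c : ι → κ) (w : κ → V) (hw : ∀ p, v p ∈ span ℂ {w (c p)}) {U : Set ι}
    (T : Set κ) (hT : T.Finite) (h : ∀ p ∈ U, v p ≠ 0 → c p ∈ T) : rk v U ≤ T.ncard := by
  have : Fintype (w '' T) := (hT.image w).fintype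
  calc rk v U ≤ finrank ℂ (span ℂ (w '' T)) := finrank_mono (span_le.2 (by
        rintro _ ⟨p, hp, rfl⟩
        by_cases h0 : v p = 0
        · simp [h0]
        · exact span_mono (Set.singleton_subset_iff.2 (Set.mem_image_of_mem w (h p hp h0))) (hw p)))
    _ ≤ (w '' T).ncard := by
        rw [Set.ncard_eq_toFinset_card']; exact finrank_span_le_card _
    _ ≤ T.ncard := Set.ncard_image_le hT

theorem mem_span_singleton_of_rk_lt_two {U : Set ι} (h : rk v U < 2) {p q : ι} (hp : p ∈ U)
    (hq : q ∈ U) (h0 : v p ≠ 0) : v q ∈ span ℂ {v p} := by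
  have hle : span ℂ {v p} ≤ span ℂ (v '' U) :=
    span_mono (Set.singleton_subset_iff.2 ⟨p, hp, rfl⟩)
  have : finrank ℂ (span ℂ (v '' U)) ≤ finrank ℂ (span ℂ {v p}) := by
    rw [finrank_span_singleton h0]; exact Nat.le_of_lt_succ h
  rw [eq_of_le_of_finrank_le hle this]
  exact subset_span ⟨q, hq, rfl⟩

end rank

section zeroLocus

variable {d k₁ k₂ : ℕ}

/-- The point of affine space whose matrix has the columns `v p`. -/
def point (v : Col k₁ k₂ → Fin d → ℂ) : Fin d × Col k₁ k₂ → ℂ := fun q => v q.2 q.1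

theorem aeval_point_minorPoly (v : Col k₁ k₂ → Fin d → ℂ) (r : ℕ) (a : Fin r → Fin d)
    (b : Fin r → Col k₁ k₂) :
    aeval (point v) (minorPoly d k₁ k₂ r a b) =
      (Matrix.of fun i j => v (b j) (a i)).det := by
  rw [minorPoly, AlgHom.map_det]
  congr 1
  ext i j
  simp [point]

theorem forall_minorSet_aeval_eq_zero (v : Col k₁ k₂ → Fin d → ℂ) (r : ℕ)
    (U : Set (Col k₁ k₂)) :
    (∀ f ∈ minorSet d k₁ k₂ r U, aeval (point v) f = 0) ↔ rk v U < r := by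
  rw [rk_lt_iff_minors]
  constructor
  · intro h a b ha hb hU
    rw [← aeval_point_minorPoly]
    exact h _ ⟨a, b, ha, hb, hU, rfl⟩
  · rintro h _ ⟨a, b, ha, hb, hU, rfl⟩
    rw [aeval_point_minorPoly]
    exact h a b ha hb hU

theorem rk_lt_of_mem_zeroLocus {v : Col k₁ k₂ → Fin d → ℂ} {I : Ideal (MvP d k₁ k₂)}
    (hv : point v ∈ zeroLocus ℂ I) {r : ℕ} {U : Set (Col k₁ k₂)}
    (hI : minorIdeal d k₁ k₂ r U ≤ I) : rk v U < r :=
  (forall_minorSet_aeval_eq_zero v r U).1 fun f hf => hv f (hI (Ideal.subset_span hf))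

theorem rk_lt_one_iff (v : Col k₁ k₂ → Fin d → ℂ) (U : Set (Col k₁ k₂)) :
    rk v U < 1 ↔ ∀ p ∈ U, v p = 0 := by
  rw [Nat.lt_one_iff, rk, Submodule.finrank_eq_zero, span_eq_bot, Set.forall_mem_image]

theorem point_mem_zeroLocus_ISIdeal_iff (t : ℕ) (v : Col 2 k₂ → Fin d → ℂ)
    (S : Set (Col 2 k₂)) :
    point v ∈ zeroLocus ℂ (ISIdeal d k₂ t S) ↔
      (∀ p ∈ S, v p = 0) ∧ (∀ j, colOK k₂ S j → rk v (colSlice 2 k₂ j) < 2) ∧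
      (tCond k₂ S → rk v (CSet k₂ S) < t - 1) ∧
      ∀ i, rk v ((rowSlice 2 k₂ i \ S) ∪ CSet k₂ S) < t := by
  rw [ISIdeal, zeroLocus_span, Set.mem_ofPred_eq, Fin.forall_fin_two, ← rk_lt_one_iff]
  simp only [← forall_minorSet_aeval_eq_zero, FSset, Set.mem_union, Set.mem_iUnion, or_imp,
    forall_and, Set.mem_ofPred_eq, exists_prop, forall_exists_index, and_imp]
  grind

/-- A minor one of whose columns lies in `S` vanishes modulo the entries of `X_S`. -/
theorem minorPoly_mem_of_column_mem {I : Ideal (MvP d k₁ k₂)} {r : ℕ} (a : Fin r → Fin d)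
    (b : Fin r → Col k₁ k₂) (j : Fin r) (h : ∀ i, (X (i, b j) : MvP d k₁ k₂) ∈ I) :
    minorPoly d k₁ k₂ r a b ∈ I := by
  rw [minorPoly, Matrix.det_apply]
  refine I.sum_mem fun σ _ => ?_
  rw [Units.smul_def, zsmul_eq_mul]
  exact I.mul_mem_left _ (I.prod_mem (Finset.mem_univ j) (h _))

end zeroLocus

theorem fin_two_eq_or {i i' : Fin 2} (h : i ≠ i') (x : Fin 2) : x = i ∨ x = i' := by
  omega

theorem ciIdeal_le_ISIdeal (d k₂ t : ℕ) (S : Set (Col 2 k₂)) :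
    ciIdeal d 2 k₂ t ≤ ISIdeal d k₂ t S := by
  have hX : ∀ p ∈ S, ∀ i, (X (i, p) : MvP d 2 k₂) ∈ ISIdeal d k₂ t S := by
    intro p hp i
    refine Ideal.subset_span (Or.inl (Or.inl (Or.inl (Or.inl
      ⟨fun _ => i, fun _ => p, Function.injective_of_subsingleton _,
        Function.injective_of_subsingleton _, fun _ => hp, ?_⟩))))
    simp [minorPoly]
  refine sup_le (iSup_le fun j => Ideal.span_le.2 ?_) (iSup_le fun i => Ideal.span_le.2 ?_)
  · rintro _ ⟨a, b, ha, hb, hU, rfl⟩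
    by_cases hj : colOK k₂ S j
    · refine Ideal.subset_span (Or.inl (Or.inl (Or.inl (Or.inr ?_))))
      exact Set.mem_biUnion hj ⟨a, b, ha, hb, hU, rfl⟩
    · simp only [colOK, not_forall, not_not] at hj
      obtain ⟨x, hx⟩ := hj
      have hne : (b 0).1 ≠ (b 1).1 := fun h =>
        absurd (hb (Prod.ext h ((hU 0).trans (hU 1).symm))) (by simp)
      rcases fin_two_eq_or hne x with h | h
      · exact minorPoly_mem_of_column_mem a b 0 (hX _ (by
          convert hx using 1; exact Prod.ext h.symm (hU 0)))
      · exact minorPoly_mem_of_column_mem a b 1 (hX _ (by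
          convert hx using 1; exact Prod.ext h.symm (hU 1)))
  · rintro _ ⟨a, b, ha, hb, hU, rfl⟩
    by_cases hS : ∃ j, b j ∈ S
    · obtain ⟨j, hj⟩ := hS
      exact minorPoly_mem_of_column_mem a b j (hX _ hj)
    · push Not at hS
      fin_cases i
      · exact Ideal.subset_span (Or.inl (Or.inr
          ⟨a, b, ha, hb, fun j => Or.inl ⟨hU j, hS j⟩, rfl⟩))
      · exact Ideal.subset_span (Or.inr
          ⟨a, b, ha, hb, fun j => Or.inl ⟨hU j, hS j⟩, rfl⟩)

/-- `Z(i,S)`, the columns of `S` in row `i`. -/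
def zeroCols {k₂ : ℕ} (S : Set (Col 2 k₂)) (i : Fin 2) : Set (Fin k₂) := {ℓ | (i, ℓ) ∈ S}

theorem ncard_rowSlice_inter {k₂ : ℕ} (S : Set (Col 2 k₂)) (i : Fin 2) :
    (rowSlice 2 k₂ i ∩ S).ncard = (zeroCols S i).ncard := by
  rw [← Set.ncard_image_of_injective (zeroCols S i) (Prod.mk_right_injective i)]
  congr 1
  ext ⟨x, ℓ⟩
  simp only [rowSlice, zeroCols, Set.mem_inter_iff, Set.mem_ofPred_eq, Set.mem_image,
    Prod.mk.injEq]
  constructor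
  · rintro ⟨rfl, h⟩
    exact ⟨ℓ, h, rfl, rfl⟩
  · rintro ⟨_, h, rfl, rfl⟩
    exact ⟨rfl, h⟩

theorem noColumn_iff {k₂ : ℕ} (S : Set (Col 2 k₂)) :
    noColumn k₂ S ↔ ∀ i i', i ≠ i' → ∀ ℓ, (i, ℓ) ∈ S → (i', ℓ) ∉ S := by
  constructor
  · intro h i i' hne ℓ h1 h2
    refine h ℓ ?_
    rintro ⟨x, _⟩ rfl
    rcases fin_two_eq_or hne x with rfl | rfl <;> assumption
  · intro h j hj
    exact h 0 1 (by simp) j (hj rfl) (hj rfl)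

theorem minimalSubset_iff {k₂ t : ℕ} (S : Set (Col 2 k₂)) :
    minimalSubset k₂ t S ↔ S = ∅ ∨ ((∀ i i', i ≠ i' → ∀ ℓ, (i, ℓ) ∈ S → (i', ℓ) ∉ S) ∧
      (∀ i, (zeroCols S i).Nonempty) ∧ (∀ i, (zeroCols S i).ncard ≤ k₂ - t + 1) ∧
      (t = 2 → (zeroCols S 0).ncard + (zeroCols S 1).ncard = k₂)) := by
  simp only [minimalSubset, noColumn_iff, uOf, vOf, ncard_rowSlice_inter, le_min_iff,
    max_le_iff, min_add_max, Nat.one_le_iff_ne_zero, ← Nat.pos_iff_ne_zero,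
    Set.ncard_pos (Set.toFinite _), Fin.forall_fin_two (p := fun i => (zeroCols S i).Nonempty),
    Fin.forall_fin_two (p := fun i => (zeroCols S i).ncard ≤ _), min_le_max, true_and]

/-- Every point of `V(𝓘_C)` lies on `V(I_S)` for some minimal `S`. -/
theorem exists_minimalSubset_mem_zeroLocus {d k₂ t : ℕ} (ht : 2 ≤ t) (htk : t ≤ k₂)
    (v : Col 2 k₂ → Fin d → ℂ) (hv : point v ∈ zeroLocus ℂ (ciIdeal d 2 k₂ t)) :
    ∃ S, minimalSubset k₂ t S ∧ point v ∈ zeroLocus ℂ (ISIdeal d k₂ t S) := by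
  have hcol (j) : rk v (colSlice 2 k₂ j) < 2 :=
    rk_lt_of_mem_zeroLocus hv
      (le_sup_of_le_left (le_iSup (fun j => minorIdeal d 2 k₂ 2 (colSlice 2 k₂ j)) j))
  have hrow (i) : rk v (rowSlice 2 k₂ i) < t :=
    rk_lt_of_mem_zeroLocus hv
      (le_sup_of_le_right (le_iSup (fun i => minorIdeal d 2 k₂ t (rowSlice 2 k₂ i)) i))
  have hprop (i i' : Fin 2) (ℓ) (h : v (i, ℓ) ≠ 0) : v (i', ℓ) ∈ span ℂ {v (i, ℓ)} :=
    mem_span_singleton_of_rk_lt_two (hcol ℓ) (p := (i, ℓ)) (q := (i', ℓ)) rfl rfl h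
  have hspan (i : Fin 2) (p : Col 2 k₂) (h : v (i, p.2) = 0 → v p = 0) :
      v p ∈ span ℂ (v '' rowSlice 2 k₂ i) := by
    by_cases h0 : v (i, p.2) = 0
    · simp [h h0]
    · exact span_mono (Set.singleton_subset_iff.2
        (Set.mem_image_of_mem v (show (i, p.2) ∈ rowSlice 2 k₂ i from rfl)))
        (hprop i p.1 p.2 h0)
  by_cases htot : rk v Set.univ < t
  · refine ⟨∅, Or.inl rfl, (point_mem_zeroLocus_ISIdeal_iff t v ∅).2
      ⟨by simp, fun j _ => hcol j, ?_, fun i => (rk_mono (Set.subset_univ _)).trans_lt htot⟩⟩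
    simp [tCond]
  have hzero (i i' : Fin 2) (hne : i ≠ i') : ∃ ℓ, v (i, ℓ) = 0 ∧ v (i', ℓ) ≠ 0 := by
    by_contra! h
    refine htot ((rk_le_of_image_subset fun p _ => hspan i p fun h0 => ?_).trans_lt (hrow i))
    obtain ⟨x, ℓ⟩ := p
    rcases fin_two_eq_or hne x with rfl | rfl
    · exact h0
    · exact h ℓ h0
  have hN : rk v {p | v (0, p.2) ≠ 0 ∧ v (1, p.2) ≠ 0} < t - 1 := by
    by_contra! hN
    have heq (i : Fin 2) : span ℂ (v '' {p | v (0, p.2) ≠ 0 ∧ v (1, p.2) ≠ 0}) =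
        span ℂ (v '' rowSlice 2 k₂ i) := by
      refine eq_of_le_of_finrank_le (span_le.2 ?_) ?_
      · rintro _ ⟨p, hp, rfl⟩
        refine hspan i p fun h0 => ?_
        fin_cases i
        · exact absurd h0 hp.1
        · exact absurd h0 hp.2
      · exact (Nat.le_sub_one_of_lt (hrow i)).trans hN
    refine htot ((rk_le_of_image_subset (W := rowSlice 2 k₂ 0) fun p _ => ?_).trans_lt (hrow 0))
    rw [← heq 0, heq p.1]
    exact hspan p.1 p id
  let A₀ : Set (Fin k₂) := {ℓ | v (0, ℓ) = 0}
  let B₀ : Set (Fin k₂) := {ℓ | v (1, ℓ) = 0 ∧ v (0, ℓ) ≠ 0}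
  have hA₀ : A₀.Nonempty := let ⟨ℓ, h, _⟩ := hzero 0 1 (by simp); ⟨ℓ, h⟩
  have hB₀ : B₀.Nonempty := hzero 1 0 (by simp)
  have htrunc (T : Set (Fin k₂)) (hT : T.Nonempty) : ∃ T' ⊆ T, T'.Nonempty ∧
      T'.ncard ≤ k₂ - t + 1 ∧ (T' = T ∨ T'.ncard = k₂ - t + 1) := by
    by_cases h : T.ncard ≤ k₂ - t + 1
    · exact ⟨T, subset_rfl, hT, h, Or.inl rfl⟩
    · obtain ⟨T', hT', hc⟩ := Set.exists_subset_card_eq (not_le.1 h).le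
      exact ⟨T', hT', Set.nonempty_of_ncard_ne_zero (by omega), hc.le, Or.inr hc⟩
  obtain ⟨A, hAs, hAn, hAc, hA⟩ := htrunc A₀ hA₀
  obtain ⟨B, hBs, hBn, hBc, hB⟩ := htrunc B₀ hB₀
  have hdisj : Disjoint A B := Set.disjoint_left.2 fun ℓ hA hB => (hBs hB).2 (hAs hA)
  have hAB := Set.ncard_union_eq hdisj
  have hABk := Set.ncard_add_ncard_compl (A ∪ B)
  have hAk := Set.ncard_add_ncard_compl A
  have hBk := Set.ncard_add_ncard_compl B
  rw [Nat.card_eq_fintype_card, Fintype.card_fin] at hABk hAk hBk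
  have hA1 : 0 < A.ncard := (Set.ncard_pos).2 hAn
  have hB1 : 0 < B.ncard := (Set.ncard_pos).2 hBn
  let S : Set (Col 2 k₂) := {p | (p.1 = 0 ∧ p.2 ∈ A) ∨ (p.1 = 1 ∧ p.2 ∈ B)}
  have hS0 (ℓ) : ((0 : Fin 2), ℓ) ∈ S ↔ ℓ ∈ A := by simp [S]
  have hS1 (ℓ) : ((1 : Fin 2), ℓ) ∈ S ↔ ℓ ∈ B := by simp [S]
  have hZ0 : zeroCols S 0 = A := Set.ext hS0
  have hZ1 : zeroCols S 1 = B := Set.ext hS1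
  have hC (p) : p ∈ CSet k₂ S ↔ p.2 ∉ A ∧ p.2 ∉ B := by
    simp [CSet, colOK, Fin.forall_fin_two, hS0, hS1]
  have hcount (U : Set (Col 2 k₂)) (T : Set (Fin k₂)) (h : ∀ p ∈ U, p.2 ∈ T) :
      rk v U ≤ T.ncard := by
    classical
    refine rk_le_ncard Prod.snd (fun ℓ => if v (0, ℓ) = 0 then v (1, ℓ) else v (0, ℓ)) ?_ T
      T.toFinite fun p hp _ => h p hp
    rintro ⟨x, ℓ⟩
    dsimp only
    split_ifs with h0
    · fin_cases x
      · simp [h0]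
      · exact mem_span_singleton_self _
    · exact hprop 0 x ℓ h0
  refine ⟨S, (minimalSubset_iff S).2 (Or.inr ⟨?_, ?_, ?_, ?_⟩),
    (point_mem_zeroLocus_ISIdeal_iff t v S).2 ⟨?_, fun j _ => hcol j, fun _ => ?_, ?_⟩⟩
  · intro i i' hne ℓ h h'
    have : ℓ ∈ A ∧ ℓ ∈ B := by
      rw [← hS0, ← hS1]
      rcases fin_two_eq_or hne 0 with rfl | rfl <;> rcases fin_two_eq_or hne 1 with h1 | h1 <;>
        simp_all
    exact Set.disjoint_left.1 hdisj this.1 this.2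
  · simp [Fin.forall_fin_two, hZ0, hZ1, hAn, hBn]
  · simp [Fin.forall_fin_two, hZ0, hZ1, hAc, hBc]
  · rintro rfl
    rw [hZ0, hZ1, ← hAB]
    have h1 : rk v {p | v (0, p.2) ≠ 0 ∧ v (1, p.2) ≠ 0} = 0 := by omega
    have h2 := (rk_lt_one_iff v _).1 (h1.trans_lt one_pos)
    have hcov : A₀ ∪ B₀ = Set.univ := by
      ext ℓ
      by_contra hℓ
      simp only [A₀, B₀, Set.mem_union, Set.mem_ofPred_eq, Set.mem_univ, iff_true] at hℓ
      push Not at hℓ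
      have h1 : v (1, ℓ) ≠ 0 := fun h => hℓ.1 (hℓ.2 h)
      exact hℓ.1 (h2 (0, ℓ) ⟨hℓ.1, h1⟩)
    rcases hA with rfl | hA
    · rcases hB with rfl | hB
      · rw [hcov, Set.ncard_univ, Nat.card_eq_fintype_card, Fintype.card_fin]
      · omega
    · omega
  · rintro ⟨x, ℓ⟩ (⟨rfl, h⟩ | ⟨rfl, h⟩)
    · exact hAs h
    · exact (hBs h).1
  · by_cases htr : A = A₀ ∧ B = B₀
    · refine (rk_mono fun p hp => ?_).trans_lt hN
      obtain ⟨h1, h2⟩ := (hC p).1 hp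
      rw [htr.1] at h1
      rw [htr.2] at h2
      exact ⟨h1, fun h => h2 ⟨h, h1⟩⟩
    · have := hcount (CSet k₂ S) (A ∪ B)ᶜ fun p hp => by simpa using (hC p).1 hp
      have : A.ncard = k₂ - t + 1 ∨ B.ncard = k₂ - t + 1 := by tauto
      omega
  · rw [Fin.forall_fin_two]
    constructor
    · rcases hA with rfl | hA
      · refine (rk_le_of_image_subset fun p hp => hspan 0 p fun h0 => ?_).trans_lt (hrow 0)
        rcases hp with ⟨hp, _⟩ | hp
        · rw [← h0, ← show p.1 = 0 from hp]
        · exact absurd h0 ((hC p).1 hp).1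
      · have := hcount ((rowSlice 2 k₂ 0 \ S) ∪ CSet k₂ S) Aᶜ (by
          rintro ⟨x, ℓ⟩ (⟨hx, h⟩ | h)
          · obtain rfl : x = 0 := hx
            rwa [hS0] at h
          · exact ((hC _).1 h).1)
        omega
    · rcases hB with rfl | hB
      · refine (rk_le_of_image_subset fun p hp => hspan 1 p fun h1 => ?_).trans_lt (hrow 1)
        obtain ⟨x, ℓ⟩ := p
        rcases hp with ⟨hp, _⟩ | hp
        · rw [← h1, ← show x = 1 from hp]
        · have h0 : v (0, ℓ) = 0 := by_contra fun h => ((hC _).1 hp).2 ⟨h1, h⟩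
          fin_cases x
          · exact h0
          · exact h1
      · have := hcount ((rowSlice 2 k₂ 1 \ S) ∪ CSet k₂ S) Bᶜ (by
          rintro ⟨x, ℓ⟩ (⟨hx, h⟩ | h)
          · obtain rfl : x = 1 := hx
            rwa [hS1] at h
          · exact ((hC _).1 h).2)
        omega

/-- The entries indexed by `S` are the only variables forced to vanish on `V(I_S)`. -/
theorem subset_of_ISIdeal_le {d k₂ t : ℕ} (ht : 2 ≤ t) (htd : t ≤ d) {S S' : Set (Col 2 k₂)}
    (hS : minimalSubset k₂ t S) (h : ISIdeal d k₂ t S' ≤ ISIdeal d k₂ t S) : S' ⊆ S := by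
  classical
  let w : Fin d → ℂ := fun _ => 1
  have hw : w ≠ 0 := fun h0 => one_ne_zero (congrFun h0 ⟨0, by omega⟩)
  let v : Col 2 k₂ → Fin d → ℂ := fun p => if p ∈ S then 0 else w
  have hrk (U) : rk v U ≤ 1 := by
    refine (rk_le_ncard (fun _ => ()) (fun _ => w) (fun p => ?_) {()} (Set.toFinite _)
      (by simp)).trans (Set.ncard_singleton _).le
    by_cases hp : p ∈ S
    · simp [v, hp]
    · simp only [v, hp, if_false]
      exact mem_span_singleton_self w
  have hv : point v ∈ zeroLocus ℂ (ISIdeal d k₂ t S) := by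
    refine (point_mem_zeroLocus_ISIdeal_iff t v S).2 ⟨fun p hp => by simp [v, hp],
      fun j _ => (hrk _).trans_lt one_lt_two, fun hc => ?_, fun i => (hrk _).trans_lt ht⟩
    rcases (minimalSubset_iff S).1 hS with rfl | ⟨hcol, -, -, ht2⟩
    · simp [tCond] at hc
    rcases ht.eq_or_lt with rfl | ht
    · refine (rk_lt_one_iff v _).2 fun p hp => ?_
      have hdisj : Disjoint (zeroCols S 0) (zeroCols S 1) :=
        Set.disjoint_left.2 fun ℓ => hcol 0 1 (by simp) ℓ
      have huniv : zeroCols S 0 ∪ zeroCols S 1 = Set.univ := by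
        refine Set.eq_of_subset_of_ncard_le (Set.subset_univ _) ?_
        rw [Set.ncard_union_eq hdisj, ht2 rfl, Set.ncard_univ, Nat.card_eq_fintype_card,
          Fintype.card_fin]
      rcases huniv.ge (Set.mem_univ p.2) with h0 | h1
      · exact absurd h0 (hp 0)
      · exact absurd h1 (hp 1)
    · exact (hrk _).trans_lt (by omega)
  intro p hp
  by_contra hpS
  have := ((point_mem_zeroLocus_ISIdeal_iff t v S').1 (zeroLocus_anti_mono h hv)).1 p hp
  simp only [v, hpS, if_false] at this
  exact hw this

theorem superset_of_ISIdeal_le {d k₂ t : ℕ} (ht : 2 ≤ t) (htk : t ≤ k₂) (htd : t ≤ d)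
    {S S' : Set (Col 2 k₂)} (hS : minimalSubset k₂ t S)
    (h : ISIdeal d k₂ t S' ≤ ISIdeal d k₂ t S) : S ⊆ S' := by
  classical
  have hsub := subset_of_ISIdeal_le ht htd hS h
  rcases (minimalSubset_iff S).1 hS with rfl | ⟨hcol, hne, hcard, -⟩
  · exact Set.empty_subset _
  rintro ⟨i, ℓ⟩ hp
  by_contra hp'
  obtain ⟨i', hi⟩ := exists_ne i
  obtain ⟨m, hm⟩ := hne i'
  replace hm : (i', m) ∈ S := hm
  have hmi : (i, m) ∉ S := hcol i' i hi m hm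
  have hℓi : (i', ℓ) ∉ S := hcol i i' hi.symm ℓ hp
  obtain ⟨T, hmT, hTS, hTc⟩ : ∃ T : Set (Fin k₂), {m} ⊆ T ∧ T ⊆ (zeroCols S i)ᶜ ∧
      T.ncard = t - 1 := by
    refine Set.exists_subsuperset_card_eq (Set.singleton_subset_iff.2 hmi) ?_ ?_
    · rw [Set.ncard_singleton]; omega
    · have := Set.ncard_add_ncard_compl (zeroCols S i)
      rw [Nat.card_eq_fintype_card, Fintype.card_fin] at this
      have := hcard i
      omega
  replace hmT : m ∈ T := hmT rfl
  have hℓT : ℓ ∉ T := fun h => hTS h hp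
  have hins : (insert ℓ T).ncard = t := by
    rw [Set.ncard_insert_of_notMem hℓT, hTc]; omega
  obtain ⟨φ⟩ : Nonempty ((insert ℓ T : Set (Fin k₂)) ↪ Fin d) := by
    refine Function.Embedding.nonempty_of_card_le ?_
    rw [Fintype.card_fin, ← Nat.card_eq_fintype_card, Nat.card_coe_set_eq, hins]
    exact htd
  let e : Fin k₂ → Fin d → ℂ := fun n =>
    if hn : n ∈ insert ℓ T then Pi.single (φ ⟨n, hn⟩) 1 else 0
  let v : Col 2 k₂ → Fin d → ℂ := fun p =>
    if p ∉ S ∧ (p.2 ∈ T ∨ p = (i', ℓ)) then e p.2 else 0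
  have hv_of_ne (p) (h0 : v p ≠ 0) : p ∉ S ∧ (p.2 ∈ T ∨ p = (i', ℓ)) := by
    by_contra hc
    exact h0 (if_neg hc)
  have hrk (U : Set (Col 2 k₂)) (W : Set (Fin k₂)) (hW : ∀ p ∈ U, v p ≠ 0 → p.2 ∈ W) :
      rk v U ≤ W.ncard := by
    refine rk_le_ncard Prod.snd e (fun p => ?_) W W.toFinite hW
    by_cases hc : p ∉ S ∧ (p.2 ∈ T ∨ p = (i', ℓ))
    · simp only [v, if_pos hc]
      exact mem_span_singleton_self _
    · simp only [v, if_neg hc]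
      exact zero_mem _
  have hTm : (T \ {m}).ncard = t - 2 := by
    rw [Set.ncard_sdiff_singleton_of_mem hmT, hTc]; omega
  have hCT (p) (hpC : p ∈ CSet k₂ S) (h0 : v p ≠ 0) : p.2 ∈ T \ {m} := by
    refine ⟨(hv_of_ne p h0).2.resolve_right ?_, ?_⟩
    · rintro rfl
      exact hpC i hp
    · intro hpm
      exact hpC i' (by rwa [show p.2 = m from hpm])
  have hv : point v ∈ zeroLocus ℂ (ISIdeal d k₂ t S) := by
    refine (point_mem_zeroLocus_ISIdeal_iff t v S).2 ⟨fun p hpS => ?_, fun j _ => ?_,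
      fun _ => ?_, fun x => ?_⟩
    · by_contra h0
      exact (hv_of_ne p h0).1 hpS
    · refine (hrk _ {j} fun p hpj _ => hpj).trans_lt ?_
      rw [Set.ncard_singleton]; exact one_lt_two
    · refine (hrk _ _ hCT).trans_lt ?_
      omega
    · rcases fin_two_eq_or hi.symm x with rfl | rfl
      · refine (hrk _ T ?_).trans_lt (by omega)
        rintro p (⟨hx, -⟩ | hpC) h0
        · refine (hv_of_ne p h0).2.resolve_right ?_
          rintro rfl
          exact hi hx
        · exact (hCT p hpC h0).1
      · refine (hrk _ (insert ℓ (T \ {m})) ?_).trans_lt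
          ((Set.ncard_insert_le _ _).trans_lt (by omega))
        rintro p (⟨hx, hpS⟩ | hpC) h0
        · rcases (hv_of_ne p h0).2 with hpT | rfl
          · refine Or.inr ⟨hpT, fun hpm => hpS ?_⟩
            rwa [show p = (x, m) from Prod.ext hx hpm]
          · exact Or.inl rfl
        · exact Or.inr (hCT p hpC h0)
  have hlt := ((point_mem_zeroLocus_ISIdeal_iff t v S').1 (zeroLocus_anti_mono h hv)).2.2.2 i
  have hli : LinearIndependent ℂ fun n : (insert ℓ T : Set (Fin k₂)) => e n := by
    convert (Pi.basisFun ℂ (Fin d)).linearIndependent.comp φ φ.injective using 2 with n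
    simp only [e, dif_pos n.2, Function.comp_apply, Pi.basisFun_apply]
  refine hlt.not_ge ?_
  calc t = finrank ℂ (span ℂ (Set.range fun n : (insert ℓ T : Set (Fin k₂)) => e n)) := by
        rw [finrank_span_eq_card hli, ← Nat.card_eq_fintype_card, Nat.card_coe_set_eq, hins]
    _ ≤ _ := finrank_mono (span_mono ?_)
  rintro _ ⟨⟨n, hn⟩, rfl⟩
  rcases hn with rfl | hnT
  · refine ⟨(i', n), Or.inr fun x hx => ?_, if_pos ⟨hℓi, Or.inr rfl⟩⟩
    rcases fin_two_eq_or hi x with rfl | rfl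
    · exact hℓi (hsub hx)
    · exact hp' hx
  · have hnS : (i, n) ∉ S := hTS hnT
    exact ⟨(i, n), Or.inl ⟨rfl, fun hx => hnS (hsub hx)⟩, if_pos ⟨hnS, Or.inl hnT⟩⟩

/-- for `k₁ = 2` and `2 ≤ t ≤ min(k₂, d)`, `√𝓘_C = ⋂ √(I_S)` over
all minimal subsets `S ⊆ [2]×[k₂]`; moreover every `I_S` appearing in the
intersection is minimal among `{I_{S'} : S' ⊆ [2]×[k₂]}`. -/
theorem radical_ciIdeal_eq_iInf_minimal
    (d k₂ t : ℕ) (ht : 2 ≤ t) (htk : t ≤ k₂) (htd : t ≤ d) :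
    ((ciIdeal d 2 k₂ t).radical =
      ⨅ (S : Set (Col 2 k₂)) (_ : minimalSubset k₂ t S), (ISIdeal d k₂ t S).radical) ∧
    ∀ S : Set (Col 2 k₂), minimalSubset k₂ t S →
      ¬ ∃ S' : Set (Col 2 k₂), ISIdeal d k₂ t S' < ISIdeal d k₂ t S := by
  refine ⟨le_antisymm ?_ ?_, fun S hS => ?_⟩
  · exact le_iInf₂ fun S _ => Ideal.radical_mono (ciIdeal_le_ISIdeal d k₂ t S)
  · intro f hf
    rw [← vanishingIdeal_zeroLocus_eq_radical (K := ℂ) (ciIdeal d 2 k₂ t),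
      mem_vanishingIdeal_iff]
    intro x hx
    obtain ⟨S, hS, hxS⟩ :=
      exists_minimalSubset_mem_zeroLocus ht htk (fun p i => x (i, p)) hx
    exact radical_le_vanishingIdeal_zeroLocus _ ((mem_iInf _).1 ((mem_iInf _).1 hf S) hS)
      _ hxS
  · rintro ⟨S', hlt⟩
    have hle := hlt.le
    rw [(subset_of_ISIdeal_le ht htd hS hle).antisymm
      (superset_of_ISIdeal_le ht htk htd hS hle)] at hlt
    exact hlt.false

end CI
end
end

section
/- Fix integers 2 ≤ t ≤ k₂, and let 𝒮 = {(0,0)} ∪ {(u,v) ∈ ℤ×ℤ : 1 ≤ u ≤ v ≤ k₂ − t + 1, u + v ≤ k₂, and u + v = k₂ whenever t = 2}. Then the cardinality of 𝒮 is: ⌊k₂/2⌋ + 1 if t = 2; (k₂−t+1)(k₂−t+2)/2 + 1 if t ≥ 3 and t − 1 ≥ k₂/2; (k₂² − 2t² + 6t)/4 if t ≥ 3, t − 1 < k₂/2, and k₂ is even; and (k₂² − 2t² + 6t − 1)/4 if t ≥ 3, t − 1 < k₂/2, and k₂ is odd. -/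
noncomputable section

open MvPolynomial

namespace CI

/-- The pairs `(u, v)` with `1 ≤ u ≤ v ≤ n` and `u + v ≤ k`, fibred over `v`, are counted by a
sum of minima. -/
lemma ncard_pairs_eq_sum_min (n k : ℕ) :
    {p : ℤ × ℤ | 1 ≤ p.1 ∧ p.1 ≤ p.2 ∧ p.2 ≤ n ∧ p.1 + p.2 ≤ k}.ncard =
      ∑ v ∈ Finset.range (n + 1), min v (k - v) := by
  have h : {p : ℤ × ℤ | 1 ≤ p.1 ∧ p.1 ≤ p.2 ∧ p.2 ≤ n ∧ p.1 + p.2 ≤ k} =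
      (fun x : (_ : ℕ) × ℕ => ((x.2 : ℤ), (x.1 : ℤ))) ''
        ((Finset.range (n + 1)).sigma fun v => Finset.Icc 1 (min v (k - v)) :
          Finset ((_ : ℕ) × ℕ)) := by
    ext ⟨u, v⟩
    simp only [Set.mem_ofPred_eq, Set.mem_image, Finset.mem_coe, Finset.mem_sigma,
      Finset.mem_range, Finset.mem_Icc, Prod.mk.injEq]
    constructor
    · rintro ⟨h1, h2, h3, h4⟩
      exact ⟨⟨v.toNat, u.toNat⟩, by simp only; omega, by simp only; omega⟩
    · rintro ⟨⟨a, b⟩, h, rfl, rfl⟩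
      simp only at h ⊢
      omega
  rw [h, Set.ncard_image_of_injective, Set.ncard_coe_finset, Finset.card_sigma]
  · simp
  · rintro ⟨a, b⟩ ⟨c, d⟩ h
    simp only [Prod.mk.injEq, Nat.cast_inj] at h
    obtain ⟨rfl, rfl⟩ := h
    rfl

lemma ncard_pairs_add_eq (k : ℕ) :
    {p : ℤ × ℤ | 1 ≤ p.1 ∧ p.1 ≤ p.2 ∧ p.1 + p.2 = k}.ncard = k / 2 := by
  have h : {p : ℤ × ℤ | 1 ≤ p.1 ∧ p.1 ≤ p.2 ∧ p.1 + p.2 = k} =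
      (fun u : ℕ => ((u : ℤ), (k : ℤ) - u)) '' (Finset.Icc 1 (k / 2) : Finset ℕ) := by
    ext ⟨u, v⟩
    simp only [Set.mem_ofPred_eq, Set.mem_image, Finset.mem_coe, Finset.mem_Icc, Prod.mk.injEq]
    constructor
    · rintro ⟨h1, h2, h3⟩
      exact ⟨u.toNat, by omega, by omega⟩
    · rintro ⟨a, h, rfl, rfl⟩
      omega
  rw [h, Set.ncard_image_of_injective, Set.ncard_coe_finset]
  · simp
  · intro a b h
    simpa using congrArg Prod.fst h

lemma two_mul_sum_min_of_two_mul_le {n k : ℕ} (h : 2 * n ≤ k) :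
    2 * ∑ v ∈ Finset.range (n + 1), min v (k - v) = n * (n + 1) := by
  rw [Finset.sum_congr rfl fun v hv => min_eq_left (b := k - v)
    (by have := Finset.mem_range.1 hv; omega), mul_comm, Finset.sum_range_id_mul_two]
  simp [mul_comm]

lemma two_mul_sum_min_add {n k : ℕ} (hkn : k / 2 ≤ n) (hn : n ≤ k) :
    2 * (∑ v ∈ Finset.range (n + 1), min v (k - v) : ℕ) + ((k : ℤ) - n) * (k - n - 1) =
      2 * (k / 2 : ℕ) * (k - (k / 2 : ℕ)) := by
  induction n, hkn using Nat.le_induction with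
  | base =>
    have h := two_mul_sum_min_of_two_mul_le (n := k / 2) (k := k) (by omega)
    zify at h
    have hk : k = 2 * (k / 2) ∨ k = 2 * (k / 2) + 1 := by omega
    push_cast
    rw [h]
    generalize hm : k / 2 = m at hk
    have hm' : (k : ℤ) / 2 = m := by omega
    rw [hm']
    rcases hk with rfl | rfl <;> push_cast <;> ring
  | succ n hkn ih =>
    have ih := ih (by omega)
    rw [Finset.sum_range_succ, min_eq_right (by omega), Nat.cast_add, Nat.cast_sub hn]
    push_cast at ih ⊢
    linear_combination ih

/-- the number of combinatorial types
`𝒮 = {(0,0)} ∪ {(u,v) : 1 ≤ u ≤ v ≤ k₂ − t + 1, u + v ≤ k₂, and u + v = k₂ if t = 2}`. -/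
theorem card_combinatorial_types (k₂ t : ℕ) (ht : 2 ≤ t) (htk : t ≤ k₂) :
    let 𝒮 : Set (ℤ × ℤ) :=
      {((0 : ℤ), (0 : ℤ))} ∪
        { p : ℤ × ℤ | 1 ≤ p.1 ∧ p.1 ≤ p.2 ∧ p.2 ≤ (k₂ : ℤ) - (t : ℤ) + 1 ∧
          p.1 + p.2 ≤ (k₂ : ℤ) ∧ (t = 2 → p.1 + p.2 = (k₂ : ℤ)) }
    (t = 2 → 𝒮.ncard = k₂ / 2 + 1) ∧
    (3 ≤ t → k₂ ≤ 2 * (t - 1) →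
      𝒮.ncard = (k₂ - t + 1) * (k₂ - t + 2) / 2 + 1) ∧
    (3 ≤ t → 2 * (t - 1) < k₂ → Even k₂ →
      𝒮.ncard = (k₂ ^ 2 - 2 * t ^ 2 + 6 * t) / 4) ∧
    (3 ≤ t → 2 * (t - 1) < k₂ → Odd k₂ →
      𝒮.ncard = (k₂ ^ 2 - 2 * t ^ 2 + 6 * t - 1) / 4) := by
  intro 𝒮
  set T : Set (ℤ × ℤ) := { p : ℤ × ℤ | 1 ≤ p.1 ∧ p.1 ≤ p.2 ∧ p.2 ≤ (k₂ : ℤ) - (t : ℤ) + 1 ∧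
    p.1 + p.2 ≤ (k₂ : ℤ) ∧ (t = 2 → p.1 + p.2 = (k₂ : ℤ)) } with hT
  have hfin : T.Finite := (Set.finite_Icc ((0, 0) : ℤ × ℤ) (k₂, k₂)).subset <| by
    rintro ⟨u, v⟩ ⟨h1, h2, h3, h4, -⟩
    simp only at h1 h2 h3 h4
    simp only [Set.mem_Icc, Prod.mk_le_mk]
    omega
  have hcard : 𝒮.ncard = T.ncard + 1 := by
    have h0 : ((0 : ℤ), (0 : ℤ)) ∉ T := fun h => by simpa using h.1
    rw [← Set.ncard_insert_of_notMem h0 hfin, Set.insert_eq]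
  have hsum (h3 : 3 ≤ t) :
      T.ncard = ∑ v ∈ Finset.range (k₂ - t + 1 + 1), min v (k₂ - v) := by
    rw [← ncard_pairs_eq_sum_min, hT]
    congr 1
    ext p
    simp only [Set.mem_ofPred_eq]
    omega
  rw [hcard]
  have hlarge (h3 : 3 ≤ t) (h : 2 * (t - 1) < k₂) :
      2 * (T.ncard : ℤ) + ((t : ℤ) - 1) * (t - 2) = 2 * (k₂ / 2 : ℕ) * (k₂ - (k₂ / 2 : ℕ)) := by
    have := two_mul_sum_min_add (n := k₂ - t + 1) (k := k₂) (by omega) (by omega)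
    rw [← hsum h3, Nat.cast_add, Nat.cast_sub htk] at this
    push_cast at this ⊢
    linear_combination this
  have hle (h3 : 3 ≤ t) (h : 2 * (t - 1) < k₂) : 2 * t ^ 2 ≤ k₂ ^ 2 := by
    have : 2 * t ≤ k₂ + 1 := by omega
    nlinarith
  refine ⟨?_, ?_, ?_, ?_⟩
  · rintro rfl
    rw [← ncard_pairs_add_eq, hT]
    congr 2
    ext p
    simp only [Set.mem_ofPred_eq, forall_const]
    omega
  · intro h3 h
    have := two_mul_sum_min_of_two_mul_le (n := k₂ - t + 1) (k := k₂) (by omega)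
    rw [← hsum h3] at this
    rw [show k₂ - t + 2 = k₂ - t + 1 + 1 from rfl, ← this]
    omega
  · rintro h3 h ⟨m, rfl⟩
    have h1 := hlarge h3 h
    have h2 := hle h3 h
    rw [show (m + m) / 2 = m by omega] at h1
    suffices (m + m) ^ 2 - 2 * t ^ 2 + 6 * t = 4 * (T.ncard + 1) by omega
    zify [h2]
    push_cast at h1
    linear_combination -2 * h1
  · rintro h3 h ⟨m, rfl⟩
    have h1 := hlarge h3 h
    have h2 := hle h3 h
    rw [show (2 * m + 1) / 2 = m by omega] at h1
    suffices (2 * m + 1) ^ 2 - 2 * t ^ 2 + 6 * t = 4 * (T.ncard + 1) + 1 by omega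
    zify [h2]
    push_cast at h1
    linear_combination -2 * h1

end CI
end
end

section
/- Let 2 ≤ k₁ and 2 ≤ t ≤ min(k₂, d). The set F_∅ = F_t(X) ∪ ⋃_{j∈[k₂]} F_2(X_{C_j}) is a Gröbner basis, with respect to the lexicographic order ≺, of the ideal I_∅ = I_t(X) + Σ_{j∈[k₂]} I_2(X_{C_j}): for every nonzero f ∈ I_∅ there exists g ∈ F_∅ whose ≺-leading monomial divides the ≺-leading monomial of f. -/
noncomputable section

open MvPolynomial

namespace CI

/-! ### Strict chains and rank conditions -/

/-- `S` contains a chain of length `k`, strictly increasing in both coordinates, all of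
whose members lie weakly beyond `(i, j)`. -/
def HasChain (S : Set (ℕ × ℕ)) : ℕ → ℕ → ℕ → Prop
  | 0, _, _ => True
  | k + 1, i, j => ∃ i' j', i ≤ i' ∧ j ≤ j' ∧ (i', j') ∈ S ∧ HasChain S k (i' + 1) (j' + 1)

lemma HasChain.mono {S T : Set (ℕ × ℕ)} (hST : S ⊆ T) :
    ∀ {k i j i' j' : ℕ}, i' ≤ i → j' ≤ j → HasChain S k i j → HasChain T k i' j'
  | 0, _, _, _, _, _, _, _ => trivial
  | _ + 1, _, _, _, _, hi, hj, ⟨a, b, ha, hb, hab, h⟩ =>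
    ⟨a, b, hi.trans ha, hj.trans hb, hST hab, HasChain.mono hST le_rfl le_rfl h⟩

lemma HasChain.of_le {S : Set (ℕ × ℕ)} :
    ∀ {k l i j : ℕ}, l ≤ k → HasChain S k i j → HasChain S l i j
  | _, 0, _, _, _, _ => trivial
  | 0, _ + 1, _, _, h, _ => absurd h (by omega)
  | _ + 1, _ + 1, _, _, hl, ⟨a, b, ha, hb, hab, h⟩ =>
    ⟨a, b, ha, hb, hab, HasChain.of_le (by omega) h⟩

lemma HasChain.exists_strictMono {S : Set (ℕ × ℕ)} :
    ∀ {k i j : ℕ}, HasChain S k i j → ∃ u v : Fin k → ℕ, StrictMono u ∧ StrictMono v ∧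
      ∀ p, i ≤ u p ∧ j ≤ v p ∧ (u p, v p) ∈ S
  | 0, _, _, _ => ⟨Fin.elim0, Fin.elim0, fun p => p.elim0, fun p => p.elim0, fun p => p.elim0⟩
  | k + 1, i, j, ⟨a, b, ha, hb, hab, h⟩ => by
    obtain ⟨u, v, hu, hv, huv⟩ := HasChain.exists_strictMono h
    refine ⟨Fin.cons a u, Fin.cons b v, ?_, ?_, ?_⟩
    · intro p q hpq
      cases q using Fin.cases with
      | zero => exact absurd hpq (by simp)
      | succ q =>
        cases p using Fin.cases with
        | zero => simpa using (huv q).1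
        | succ p => simpa using hu (by simpa using hpq)
    · intro p q hpq
      cases q using Fin.cases with
      | zero => exact absurd hpq (by simp)
      | succ q =>
        cases p using Fin.cases with
        | zero => simpa using (huv q).2.1
        | succ p => simpa using hv (by simpa using hpq)
    · intro p
      cases p using Fin.cases with
      | zero => exact ⟨ha, hb, hab⟩
      | succ p =>
        obtain ⟨h1, h2, h3⟩ := huv p
        simp only [Fin.cons_succ]
        exact ⟨by omega, by omega, h3⟩

/-- The `j`-th column of `Y`, cut off to the rows in `[i, d)`. -/
def truncCol (d i : ℕ) (Y : ℕ × ℕ → ℂ) (j : ℕ) : Fin d → ℂ :=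
  fun x => if i ≤ x.1 then Y (x.1, j) else 0

/-- The span of the columns of `Y` in `[j, n)`, cut off to the rows in `[i, d)`. -/
def tailSpan (d n i : ℕ) (Y : ℕ × ℕ → ℂ) (j : ℕ) : Submodule ℂ (Fin d → ℂ) :=
  Submodule.span ℂ (truncCol d i Y '' Set.Ico j n)

/-- The rank of the submatrix of `Y` on the rows `[i, d)` and columns `[j, n)`. -/
def tailRank (d n i : ℕ) (Y : ℕ × ℕ → ℂ) (j : ℕ) : ℕ :=
  Module.finrank ℂ (tailSpan d n i Y j)

lemma truncCol_mem_tailSpan {d n i : ℕ} {Y : ℕ × ℕ → ℂ} {j j' : ℕ} (h : j ≤ j') (h' : j' < n) :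
    truncCol d i Y j' ∈ tailSpan d n i Y j :=
  Submodule.subset_span ⟨j', ⟨h, h'⟩, rfl⟩

lemma tailSpan_le_iff {d n i : ℕ} {Y : ℕ × ℕ → ℂ} {j : ℕ} {W : Submodule ℂ (Fin d → ℂ)} :
    tailSpan d n i Y j ≤ W ↔ ∀ j', j ≤ j' → j' < n → truncCol d i Y j' ∈ W := by
  rw [tailSpan, Submodule.span_le, Set.image_subset_iff]
  exact ⟨fun h j' h1 h2 => h ⟨h1, h2⟩, fun h j' hj' => h j' hj'.1 hj'.2⟩

/-- The linear map replacing the `i`-th coordinate by zero. -/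
def dropRow (d i : ℕ) : (Fin d → ℂ) →ₗ[ℂ] (Fin d → ℂ) where
  toFun u x := if x.1 = i then 0 else u x
  map_add' u v := by ext x; by_cases h : x.1 = i <;> simp [h]
  map_smul' c u := by ext x; by_cases h : x.1 = i <;> simp [h]

lemma dropRow_truncCol (d i : ℕ) (Y : ℕ × ℕ → ℂ) (j : ℕ) :
    dropRow d i (truncCol d i Y j) = truncCol d (i + 1) Y j := by
  ext x
  simp only [dropRow, truncCol, LinearMap.coe_mk, AddHom.coe_mk]
  split_ifs <;> first | rfl | omega

lemma map_dropRow_tailSpan (d n i : ℕ) (Y : ℕ × ℕ → ℂ) (j : ℕ) :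
    (tailSpan d n i Y j).map (dropRow d i) = tailSpan d n (i + 1) Y j := by
  rw [tailSpan, Submodule.map_span, tailSpan, Set.image_image]
  simp only [dropRow_truncCol]

lemma tailRank_succ_le (d n i : ℕ) (Y : ℕ × ℕ → ℂ) (j : ℕ) :
    tailRank d n (i + 1) Y j ≤ tailRank d n i Y j := by
  rw [tailRank, ← map_dropRow_tailSpan]
  exact Submodule.finrank_map_le _ _

/-- The `i`-th coordinate vector (zero if `d ≤ i`). -/
def rowVec (d i : ℕ) : Fin d → ℂ := fun x => if x.1 = i then 1 else 0

lemma truncCol_eq_add (d i : ℕ) (Y : ℕ × ℕ → ℂ) (j : ℕ) :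
    truncCol d i Y j = truncCol d (i + 1) Y j + Y (i, j) • rowVec d i := by
  ext x
  simp only [truncCol, rowVec, Pi.add_apply, Pi.smul_apply, smul_eq_mul]
  by_cases h : x.1 = i
  · subst h; simp
  · split_ifs <;> first | omega | simp

lemma finrank_le_of_le_sup_span {d : ℕ} {W T : Submodule ℂ (Fin d → ℂ)} {u : Fin d → ℂ}
    (h : W ≤ T ⊔ Submodule.span ℂ {u}) : Module.finrank ℂ W ≤ Module.finrank ℂ T + 1 :=
  (Submodule.finrank_mono h).trans
    ((Submodule.finrank_add_le_finrank_add_finrank _ _).trans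
      (Nat.add_le_add_left ((finrank_span_le_card {u}).trans (by simp)) _))

lemma tailRank_le_succ (d n i : ℕ) (Y : ℕ × ℕ → ℂ) (j : ℕ) :
    tailRank d n i Y j ≤ tailRank d n (i + 1) Y j + 1 := by
  refine finrank_le_of_le_sup_span (u := rowVec d i) (tailSpan_le_iff.2 fun j' h1 h2 => ?_)
  rw [truncCol_eq_add]
  exact Submodule.add_mem_sup (truncCol_mem_tailSpan h1 h2)
    (Submodule.smul_mem _ _ (Submodule.mem_span_singleton_self _))

lemma tailRank_congr {d n i j : ℕ} {Y Z : ℕ × ℕ → ℂ}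
    (h : ∀ j', j ≤ j' → j' < n → truncCol d i Y j' = truncCol d i Z j') :
    tailRank d n i Y j = tailRank d n i Z j := by
  have : tailSpan d n i Y j = tailSpan d n i Z j :=
    le_antisymm (tailSpan_le_iff.2 fun j' h1 h2 => h j' h1 h2 ▸ truncCol_mem_tailSpan h1 h2)
      (tailSpan_le_iff.2 fun j' h1 h2 => (h j' h1 h2).symm ▸ truncCol_mem_tailSpan h1 h2)
  rw [tailRank, this, tailRank]

lemma tailRank_eq_zero {d n i j : ℕ} {Y : ℕ × ℕ → ℂ}
    (h : ∀ j', j ≤ j' → j' < n → truncCol d i Y j' = 0) : tailRank d n i Y j = 0 := by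
  have : tailSpan d n i Y j = ⊥ :=
    le_bot_iff.1 (tailSpan_le_iff.2 fun j' h1 h2 => by rw [h j' h1 h2]; exact zero_mem _)
  rw [tailRank, this, finrank_bot]

/-- Either column `j` (below row `i`) depends on the later columns, or it adds to the rank. -/
lemma mem_tailSpan_or_tailRank_lt {d n i j : ℕ} (hj : j < n) (Y : ℕ × ℕ → ℂ) :
    truncCol d i Y j ∈ tailSpan d n i Y (j + 1) ∨
      tailRank d n i Y (j + 1) < tailRank d n i Y j := by
  by_cases h : truncCol d i Y j ∈ tailSpan d n i Y (j + 1)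
  · exact Or.inl h
  · refine Or.inr (Submodule.finrank_lt_finrank_of_lt (lt_of_le_of_ne ?_ ?_))
    · exact tailSpan_le_iff.2 fun j' h1 h2 => truncCol_mem_tailSpan (by omega) h2
    · intro he
      exact h (he ▸ truncCol_mem_tailSpan le_rfl hj)

/-! ### The leading coefficient with respect to one variable -/

lemma eval_update_monomial {σ : Type*} [DecidableEq σ] (v : σ) (p : σ → ℂ) (y : ℂ)
    (β : σ →₀ ℕ) (c : ℂ) :
    eval (Function.update p v y) (monomial β c) = y ^ β v * eval p (monomial (β.erase v) c) := by
  have h1 : (monomial β c : MvPolynomial σ ℂ) = monomial (β.erase v) c * X v ^ β v := by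
    rw [X_pow_eq_monomial, monomial_mul, mul_one, Finsupp.erase_add_single]
  have h2 : eval (Function.update p v y) (monomial (β.erase v) c)
      = eval p (monomial (β.erase v) c) := by
    rw [eval_monomial, eval_monomial]
    congr 1
    refine Finsupp.prod_congr fun w hw => ?_
    have : w ≠ v := by
      rintro rfl
      simp at hw
    rw [Function.update_of_ne this]
  rw [h1, map_mul, h2, map_pow, eval_X, Function.update_self, mul_comm]

/-- The coefficient of the top power of the variable `v` in `f`, together with the fact that
it vanishes at limits of zeros of `f` along which `v` goes to infinity. -/
lemma exists_leadingCoeff_variable {σ : Type*} [DecidableEq σ] (v : σ)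
    {f : MvPolynomial σ ℂ} (hf : f ≠ 0) :
    ∃ (g : MvPolynomial σ ℂ) (K : ℕ), g ≠ 0 ∧
      (∀ β ∈ g.support, ∃ β' ∈ f.support, β' v = K ∧ β = β'.erase v) ∧
      (K = 0 → ∀ p y, eval (Function.update p v y) f = eval p g) ∧
      (∀ p : ℂ → σ → ℂ, (∀ w, Continuous fun s => p s w) →
        (∀ s, s ≠ 0 → eval (Function.update (p s) v s⁻¹) f = 0) → eval (p 0) g = 0) := by
  classical
  have hne : f.support.Nonempty := by
    rwa [Finset.nonempty_iff_ne_empty, Ne, MvPolynomial.support_eq_empty]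
  obtain ⟨β₀, hβ₀, hmax⟩ := Finset.exists_max_image f.support (fun β => β v) hne
  set K := β₀ v with hK
  set g : MvPolynomial σ ℂ :=
    ∑ β ∈ f.support with β v = K, monomial (β.erase v) (coeff β f) with hg
  have hev : ∀ p y, eval (Function.update p v y) f
      = ∑ β ∈ f.support, y ^ β v * eval p (monomial (β.erase v) (coeff β f)) := by
    intro p y
    conv_lhs => rw [f.as_sum, map_sum]
    exact Finset.sum_congr rfl fun β _ => eval_update_monomial _ _ _ _ _
  have hcoeff : coeff (β₀.erase v) g = coeff β₀ f := by
    rw [hg, coeff_sum, Finset.sum_eq_single β₀]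
    · simp
    · intro β hβ hne
      rw [coeff_monomial, if_neg]
      intro he
      refine hne ?_
      rw [← Finsupp.erase_add_single v β, ← Finsupp.erase_add_single v β₀, he,
        (Finset.mem_filter.1 hβ).2]
    · intro h
      exact absurd (Finset.mem_filter.2 ⟨hβ₀, hK.symm⟩) h
  refine ⟨g, K, ?_, ?_, ?_, ?_⟩
  · intro h0
    rw [h0, coeff_zero] at hcoeff
    exact mem_support_iff.1 hβ₀ hcoeff.symm
  · intro β hβ
    obtain ⟨β', hβ', h⟩ := Finset.mem_biUnion.1 (support_sum hβ)
    have := Finset.mem_singleton.1 (support_monomial_subset h)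
    exact ⟨β', (Finset.mem_filter.1 hβ').1, (Finset.mem_filter.1 hβ').2, this⟩
  · intro h0 p y
    have hz : ∀ β ∈ f.support, β v = 0 := fun β hβ => by
      have := hmax β hβ
      omega
    rw [hev, hg, map_sum, Finset.filter_true_of_mem fun β hβ => by rw [hz β hβ, h0]]
    exact Finset.sum_congr rfl fun β hβ => by rw [hz β hβ, pow_zero, one_mul]
  · intro p hp hzero
    set F : ℂ → ℂ := fun s =>
      ∑ β ∈ f.support, s ^ (K - β v) * eval (p s) (monomial (β.erase v) (coeff β f)) with hF
    have hFc : Continuous F := by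
      refine continuous_finsetSum _ fun β _ => ?_
      refine (continuous_pow _).mul ?_
      simp only [eval_monomial]
      exact continuous_const.mul (continuous_finsetProd _ fun w _ => (hp w).pow _)
    have hF0 : F = fun _ => 0 := by
      refine hFc.ext_on (dense_compl_singleton (0 : ℂ)) continuous_const fun s hs => ?_
      have hs' : s ≠ 0 := hs
      have h1 := hzero s hs'
      rw [hev] at h1
      have h2 : F s = s ^ K * ∑ β ∈ f.support,
          s⁻¹ ^ β v * eval (p s) (monomial (β.erase v) (coeff β f)) := by
        rw [Finset.mul_sum]
        refine Finset.sum_congr rfl fun β hβ => ?_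
        have h3 : s ^ K * s⁻¹ ^ β v = s ^ (K - β v) := by
          rw [inv_pow, pow_sub₀ _ hs' (hmax β hβ)]
        rw [← mul_assoc, h3]
      rw [h2, h1, mul_zero]
    refine Eq.trans ?_ (congrFun hF0 0)
    rw [hg, map_sum, Finset.sum_filter]
    refine Finset.sum_congr rfl fun β hβ => ?_
    have := hmax β hβ
    split_ifs with h
    · rw [h, Nat.sub_self, pow_zero, one_mul]
    · rw [zero_pow (by omega), zero_mul]

/-! ### Independence of standard monomials on determinantal varieties -/

/-- The monomials involving only the variables from position `(i, j)` on (read row by row)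
whose chains below row `i` are bounded by `τ` and those from row `i` on by `ρ`. -/
def IsStdFrom (d n i j : ℕ) (ρ τ : ℕ → ℕ) (β : ℕ × ℕ →₀ ℕ) : Prop :=
  (∀ p ∈ β.support, p.1 < d ∧ p.2 < n ∧ (i < p.1 ∨ p.1 = i ∧ j ≤ p.2)) ∧
  (∀ k j', HasChain β.support k (i + 1) j' → k ≤ τ j') ∧
  (∀ k j', j ≤ j' → HasChain β.support k i j' → k ≤ ρ j')

/-- The rank conditions matching `IsStdFrom`. -/
def RankBound (d n i j : ℕ) (ρ τ : ℕ → ℕ) (Y : ℕ × ℕ → ℂ) : Prop :=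
  (∀ j', tailRank d n (i + 1) Y j' ≤ τ j') ∧ ∀ j', j ≤ j' → tailRank d n i Y j' ≤ ρ j'

/-- No nonzero combination of the monomials in `IsStdFrom` vanishes on `RankBound`. -/
def StdIndep (d n i j : ℕ) (ρ τ : ℕ → ℕ) : Prop :=
  ∀ f : MvPolynomial (ℕ × ℕ) ℂ, (∀ β ∈ f.support, IsStdFrom d n i j ρ τ β) →
    (∀ Y, RankBound d n i j ρ τ Y → eval Y f = 0) → f = 0

/-- Add `s` times the product of column `j` and row `i` to the part of `Y` beyond `(i, j)`. -/
def shear (i j : ℕ) (Y : ℕ × ℕ → ℂ) (s : ℂ) : ℕ × ℕ → ℂ := fun p =>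
  if i < p.1 ∧ j < p.2 then Y p + s * (Y (p.1, j) * Y (i, p.2)) else Y p

lemma shear_zero (i j : ℕ) (Y : ℕ × ℕ → ℂ) : shear i j Y 0 = Y := by
  ext p; simp [shear]

lemma continuous_shear (i j : ℕ) (Y : ℕ × ℕ → ℂ) (p : ℕ × ℕ) :
    Continuous fun s => shear i j Y s p := by
  unfold shear
  split_ifs <;> fun_prop

lemma truncCol_shear_of_le {d i j j' : ℕ} (h : j' ≤ j) (Y : ℕ × ℕ → ℂ) (s y : ℂ) :
    truncCol d (i + 1) (Function.update (shear i j Y s) (i, j) y) j' = truncCol d (i + 1) Y j' := by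
  ext x
  simp only [truncCol]
  split_ifs with hx
  · rw [Function.update_of_ne (by simp; omega)]
    simp only [shear]
    rw [if_neg (by omega)]
  · rfl

lemma truncCol_shear_of_gt {d i i' j j' : ℕ} (h : j < j') (hi : i ≤ i') (Y : ℕ × ℕ → ℂ) (s y : ℂ) :
    truncCol d i' (Function.update (shear i j Y s) (i, j) y) j'
      = truncCol d i' Y j' + (s * Y (i, j')) • truncCol d (max i' (i + 1)) Y j := by
  ext x
  simp only [truncCol, Pi.add_apply, Pi.smul_apply, smul_eq_mul]
  by_cases hx : i' ≤ x.1
  · rw [if_pos hx, if_pos hx, Function.update_of_ne (by simp; omega)]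
    simp only [shear]
    by_cases hx' : i < x.1
    · rw [if_pos ⟨hx', h⟩, if_pos (by omega)]
      ring
    · rw [if_neg (by omega), if_neg (by omega), mul_zero, add_zero]
  · rw [if_neg hx, if_neg hx, if_neg (by omega)]
    simp

lemma truncCol_shear_self {d i j : ℕ} (Y : ℕ × ℕ → ℂ) (s y : ℂ) :
    truncCol d i (Function.update (shear i j Y s) (i, j) y) j
      = truncCol d (i + 1) Y j + y • rowVec d i := by
  rw [truncCol_eq_add, truncCol_shear_of_le le_rfl, Function.update_self]

/-- Points with small rank beyond `(i, j)` are limits of points of `RankBound` whose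
`(i, j)` entry goes to infinity. -/
lemma rankBound_shear {d n i j : ℕ} {ρ τ : ℕ → ℕ} (hj : j < n) {Y : ℕ × ℕ → ℂ}
    (heq : ∀ j', j ≤ j' → τ j' = ρ j')
    (h1 : ∀ j', j' ≤ j → tailRank d n (i + 1) Y j' ≤ τ j')
    (h2 : ∀ j', j < j' → tailRank d n i Y j' ≤ ρ j')
    (h3 : tailRank d n (i + 1) Y (j + 1) < ρ j) {s : ℂ} (hs : s ≠ 0) :
    RankBound d n i j ρ τ (Function.update (shear i j Y s) (i, j) s⁻¹) := by
  set Z := Function.update (shear i j Y s) (i, j) s⁻¹ with hZ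
  have key : ∀ j', j < j' → tailRank d n i Z j' ≤ ρ j' := by
    intro j' hj'
    refine le_trans ?_ (h2 j' hj')
    by_cases hi : i < d
    · let L : (Fin d → ℂ) →ₗ[ℂ] (Fin d → ℂ) :=
        LinearMap.id + s • (LinearMap.proj ⟨i, hi⟩ : (Fin d → ℂ) →ₗ[ℂ] ℂ).smulRight
          (truncCol d (i + 1) Y j)
      have hL : tailSpan d n i Z j' ≤ (tailSpan d n i Y j').map L := by
        refine tailSpan_le_iff.2 fun q hq1 hq2 => ?_
        refine ⟨truncCol d i Y q, truncCol_mem_tailSpan hq1 hq2, ?_⟩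
        rw [hZ, truncCol_shear_of_gt (by omega) le_rfl, max_eq_right (by omega)]
        simp [L, truncCol, mul_smul]
      exact (Submodule.finrank_mono hL).trans (Submodule.finrank_map_le _ _)
    · rw [tailRank_eq_zero]
      · exact Nat.zero_le _
      · intro q _ _
        ext x
        have := x.2
        simp only [truncCol]
        rw [if_neg (by omega)]
        rfl
  refine ⟨fun j' => ?_, fun j' hj' => ?_⟩
  · rcases le_or_gt j' j with hle | hgt
    · refine le_trans (Submodule.finrank_mono (tailSpan_le_iff.2 fun q hq1 hq2 => ?_)) (h1 j' hle)
      rcases le_or_gt q j with hq | hq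
      · rw [hZ, truncCol_shear_of_le hq]
        exact truncCol_mem_tailSpan hq1 hq2
      · rw [hZ, truncCol_shear_of_gt hq (by omega), max_self]
        exact add_mem (truncCol_mem_tailSpan hq1 hq2)
          (Submodule.smul_mem _ _ (truncCol_mem_tailSpan hle hj))
    · rw [heq j' hgt.le]
      exact (tailRank_succ_le _ _ _ _ _).trans (key j' hgt)
  · rcases hj'.eq_or_lt with rfl | hgt
    · refine (finrank_le_of_le_sup_span (T := tailSpan d n (i + 1) Y (j + 1))
        (u := truncCol d (i + 1) Y j + s⁻¹ • rowVec d i)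
        (tailSpan_le_iff.2 fun q hq1 hq2 => ?_)).trans h3
      rcases hq1.eq_or_lt with rfl | hq
      · rw [hZ, truncCol_shear_self]
        exact Submodule.mem_sup_right (Submodule.mem_span_singleton_self _)
      · have : truncCol d i Z q = truncCol d (i + 1) Y q
            + (s * Y (i, q)) • (truncCol d (i + 1) Y j + s⁻¹ • rowVec d i) := by
          rw [hZ, truncCol_shear_of_gt hq le_rfl, max_eq_right (by omega), truncCol_eq_add,
            smul_add, smul_smul, mul_right_comm, mul_inv_cancel₀ hs, one_mul]
          abel
        rw [this]
        exact Submodule.add_mem_sup (truncCol_mem_tailSpan hq hq2)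
          (Submodule.smul_mem _ _ (Submodule.mem_span_singleton_self _))
    · exact key j' hgt

lemma truncCol_update_of_ne {d i i' j j' : ℕ} (h : i < i' ∨ j ≠ j') (Y : ℕ × ℕ → ℂ) (y : ℂ) :
    truncCol d i' (Function.update Y (i, j) y) j' = truncCol d i' Y j' := by
  ext x
  simp only [truncCol]
  split_ifs with hx
  · rw [Function.update_of_ne (by simp; omega)]
  · rfl

lemma IsStdFrom.erase {d n i j : ℕ} {ρ τ : ℕ → ℕ} {β : ℕ × ℕ →₀ ℕ}
    (h : IsStdFrom d n i j ρ τ β) : IsStdFrom d n i (j + 1) ρ τ (β.erase (i, j)) := by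
  have hsub : ((β.erase (i, j)).support : Set (ℕ × ℕ)) ⊆ β.support := by
    rw [Finsupp.support_erase]
    exact_mod_cast Finset.erase_subset _ _
  refine ⟨fun p hp => ?_, fun k j' hc => h.2.1 k j' (hc.mono hsub le_rfl le_rfl),
    fun k j' hj' hc => h.2.2 k j' (by omega) (hc.mono hsub le_rfl le_rfl)⟩
  have h1 := h.1 p (hsub hp)
  have h2 : p ≠ (i, j) := by
    rintro rfl
    simp at hp
  refine ⟨h1.1, h1.2.1, ?_⟩
  rcases h1.2.2 with h3 | ⟨h3, h4⟩
  · exact Or.inl h3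
  · refine Or.inr ⟨h3, ?_⟩
    have : p.2 ≠ j := fun h5 => h2 (Prod.ext h3 h5)
    omega

lemma IsStdFrom.succ_le_of_mem {d n i j : ℕ} {ρ τ : ℕ → ℕ} {β : ℕ × ℕ →₀ ℕ}
    (h : IsStdFrom d n i j ρ τ β) (hm : (i, j) ∈ β.support) {k j' : ℕ} (hj' : j < j')
    (hc : HasChain β.support k (i + 1) j') : k + 1 ≤ ρ j :=
  h.2.2 (k + 1) j le_rfl
    ⟨i, j, le_rfl, le_rfl, hm, hc.mono le_rfl le_rfl hj'⟩

lemma stdIndep_of_succ_row {d n i : ℕ} {ρ τ : ℕ → ℕ} (h : StdIndep d n (i + 1) 0 τ τ) {j : ℕ}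
    (hj : n ≤ j) : StdIndep d n i j ρ τ := by
  intro f hf hV
  refine h f (fun β hβ => ?_) fun Y hY => hV Y ⟨fun j' => hY.2 j' (Nat.zero_le _), ?_⟩
  · obtain ⟨h1, h2, -⟩ := hf β hβ
    refine ⟨fun p hp => ?_, fun k j' hc => h2 k j' (hc.mono le_rfl (by omega) le_rfl),
      fun k j' _ hc => h2 k j' hc⟩
    have := h1 p hp
    omega
  · intro j' hj'
    rw [tailRank_eq_zero fun q _ _ => by omega]
    exact Nat.zero_le _

/-- Processing a row from right to left. -/
lemma stdIndep_row {d n i : ℕ} (hi : i < d)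
    (hrow : ∀ ρ : ℕ → ℕ, Antitone ρ → StdIndep d n (i + 1) 0 ρ ρ) :
    ∀ (m j : ℕ), n ≤ j + m → ∀ ρ τ : ℕ → ℕ, Antitone ρ → Antitone τ →
      (∀ j', τ j' ≤ ρ j') →
      (∀ j' j'', j ≤ j' → j' ≤ j'' → τ j' = ρ j' → τ j'' = ρ j'') → StdIndep d n i j ρ τ := by
  intro m
  induction m with
  | zero =>
    intro j hn ρ τ _ hτ _ _
    exact stdIndep_of_succ_row (hrow τ hτ) (by omega)
  | succ m ih =>
    intro j hn ρ τ hρ hτ hle hinv f hf hV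
    rcases le_or_gt n j with hnj | hj
    · exact stdIndep_of_succ_row (hrow τ hτ) hnj f hf hV
    by_contra hne
    obtain ⟨g, K, hg, hsupp, hK0, hlim⟩ := exists_leadingCoeff_variable (i, j) hne
    have hstd : ∀ β ∈ g.support, IsStdFrom d n i (j + 1) ρ τ β := by
      intro β hβ
      obtain ⟨β', hβ', -, rfl⟩ := hsupp β hβ
      exact (hf β' hβ').erase
    have hinv' : ∀ j' j'', j + 1 ≤ j' → j' ≤ j'' → τ j' = ρ j' → τ j'' = ρ j'' :=
      fun j' j'' h => hinv j' j'' (by omega)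
    have hshear : ∀ Y : ℕ × ℕ → ℂ, (∀ j', j ≤ j' → τ j' = ρ j') →
        (∀ j', j' ≤ j → tailRank d n (i + 1) Y j' ≤ τ j') →
        (∀ j', j < j' → tailRank d n i Y j' ≤ ρ j') →
        tailRank d n (i + 1) Y (j + 1) < ρ j → eval Y g = 0 := by
      intro Y heq h1 h2 h3
      have := hlim (shear i j Y) (continuous_shear i j Y) fun s hs =>
        hV _ (rankBound_shear hj heq h1 h2 h3 hs)
      rwa [shear_zero] at this
    rcases (hle j).eq_or_lt with heq | hlt
    · have heq' : ∀ j', j ≤ j' → τ j' = ρ j' := fun j' hj' => hinv j j' le_rfl hj' heq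
      rcases Nat.eq_zero_or_pos K with hK | hK
      · refine hg (ih (j + 1) (by omega) ρ τ hρ hτ hle hinv' g hstd fun Y hY => ?_)
        rcases mem_tailSpan_or_tailRank_lt (d := d) (i := i + 1) hj Y with hmem | hlt
        · rw [← map_dropRow_tailSpan] at hmem
          obtain ⟨w, hw, hwv⟩ := hmem
          rw [← hK0 hK Y (w ⟨i, hi⟩)]
          refine hV _ ⟨fun j' => ?_, fun j' hj' => ?_⟩
          · rw [tailRank_congr fun q _ _ => truncCol_update_of_ne (Or.inl (by omega)) Y _]
            exact hY.1 j'
          · rcases hj'.eq_or_lt with rfl | hgt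
            · refine le_trans (Submodule.finrank_mono (t := tailSpan d n i Y (j + 1))
                (tailSpan_le_iff.2 fun q hq1 hq2 => ?_))
                ((hY.2 (j + 1) le_rfl).trans (hρ (Nat.le_succ j)))
              rcases hq1.eq_or_lt with rfl | hq
              · rw [truncCol_eq_add, truncCol_update_of_ne (Or.inl (by omega)), ← hwv,
                  Function.update_self]
                have hw' : dropRow d i w + w ⟨i, hi⟩ • rowVec d i = w := by
                  ext x
                  by_cases hx : x.1 = i
                  · obtain rfl : x = ⟨i, hi⟩ := Fin.ext hx
                    simp [dropRow, rowVec]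
                  · simp [dropRow, rowVec, hx]
                rw [hw']
                exact hw
              · rw [truncCol_update_of_ne (Or.inr (by omega))]
                exact truncCol_mem_tailSpan hq hq2
            · rw [tailRank_congr fun q _ _ => truncCol_update_of_ne (Or.inr (by omega)) Y _]
              exact hY.2 j' hgt
        · exact hshear Y heq' (fun j' _ => hY.1 j') (fun j' hj' => hY.2 j' hj')
            (hlt.trans_le ((hY.1 j).trans (hle j)))
      · set τ' : ℕ → ℕ := fun j' => if j' ≤ j then τ j' else min (τ j') (ρ j - 1) with hτ'
        have hτ'le : ∀ j', τ' j' ≤ τ j' := fun j' => by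
          simp only [hτ']; split_ifs <;> simp
        have hmem : ∀ β' ∈ f.support, β' (i, j) = K → (i, j) ∈ β'.support :=
          fun β' _ h => Finsupp.mem_support_iff.2 (by omega)
        have hρpos : 0 < ρ j := by
          obtain ⟨β, hβ⟩ : g.support.Nonempty := by
            rwa [Finset.nonempty_iff_ne_empty, Ne, MvPolynomial.support_eq_empty]
          obtain ⟨β', hβ', hβK, -⟩ := hsupp β hβ
          exact (hf β' hβ').succ_le_of_mem (k := 0) (hmem β' hβ' hβK) (Nat.lt_succ_self j) trivial
        refine hg (ih (j + 1) (by omega) ρ τ' hρ ?_ (fun j' => (hτ'le j').trans (hle j')) ?_ g ?_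
          fun Y hY => ?_)
        · intro a b hab
          have := hτ hab
          simp only [hτ']
          split_ifs <;> omega
        · intro a b ha hab
          have h1 := heq' a (by omega)
          have h2 := heq' b (by omega)
          have h3 := hτ hab
          simp only [hτ']
          rw [if_neg (by omega), if_neg (by omega)]
          omega
        · intro β hβ
          refine ⟨(hstd β hβ).1, fun k j' hc => ?_, (hstd β hβ).2.2⟩
          have h1 := (hstd β hβ).2.1 k j' hc
          obtain ⟨β', hβ', hβK, rfl⟩ := hsupp β hβ
          simp only [hτ']
          split_ifs with hjj
          · exact h1
          · refine le_min h1 (Nat.le_sub_one_of_lt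
              ((hf β' hβ').succ_le_of_mem (hmem β' hβ' hβK) (not_le.1 hjj)
              (hc.mono ?_ le_rfl le_rfl)))
            rw [Finsupp.support_erase]
            exact_mod_cast Finset.erase_subset _ _
        · refine hshear Y heq' (fun j' _ => (hY.1 j').trans (hτ'le j'))
            (fun j' hj' => hY.2 j' hj') ?_
          have := hY.1 (j + 1)
          simp only [hτ'] at this
          rw [if_neg (by omega)] at this
          omega
    · refine hg (ih (j + 1) (by omega) ρ τ hρ hτ hle hinv' g hstd fun Y hY => ?_)
      refine hlim (fun _ => Y) (fun _ => continuous_const) fun s _ => hV _ ⟨fun j' => ?_, ?_⟩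
      · rw [tailRank_congr fun q _ _ => truncCol_update_of_ne (Or.inl (by omega)) Y _]
        exact hY.1 j'
      · intro j' hj'
        rcases hj'.eq_or_lt with rfl | hgt
        · refine (tailRank_le_succ _ _ _ _ _).trans ?_
          rw [tailRank_congr fun q _ _ => truncCol_update_of_ne (Or.inl (by omega)) Y _]
          exact lt_of_le_of_lt (hY.1 j) hlt
        · rw [tailRank_congr fun q _ _ => truncCol_update_of_ne (Or.inr (by omega)) Y _]
          exact hY.2 j' hgt

lemma stdIndep_of_antitone (d n : ℕ) :
    ∀ (m i : ℕ), d ≤ i + m → ∀ ρ : ℕ → ℕ, Antitone ρ → StdIndep d n i 0 ρ ρ := by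
  intro m
  induction m with
  | zero =>
    intro i hi ρ _ f hf hV
    have h0 : ∀ β ∈ f.support, β = 0 := by
      intro β hβ
      by_contra hne
      obtain ⟨p, hp⟩ := Finsupp.support_nonempty_iff.2 hne
      have := (hf β hβ).1 p hp
      omega
    have htr : ∀ i' j', tailRank d n i' 0 j' = 0 := fun i' j' =>
      tailRank_eq_zero fun q _ _ => by ext x; simp [truncCol]
    have h1 := hV 0 ⟨fun j' => by rw [htr]; exact Nat.zero_le _,
      fun j' _ => by rw [htr]; exact Nat.zero_le _⟩
    have h2 : eval (0 : ℕ × ℕ → ℂ) f = coeff 0 f := by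
      rw [← constantCoeff_eq]; exact congrFun (congrArg _ (by simp)) f
    rw [h2] at h1
    ext β
    rw [coeff_zero]
    by_contra hne
    have := h0 β (mem_support_iff.2 hne)
    exact hne (this ▸ h1)
  | succ m ih =>
    intro i hi ρ hρ
    rcases le_or_gt d i with hd | hd
    · exact ih i (by omega) ρ hρ
    · exact stdIndep_row hd (fun ρ' hρ' => ih (i + 1) (by omega) ρ' hρ') n 0 (by omega) ρ ρ hρ hρ
        (fun _ => le_rfl) fun _ _ _ _ _ => rfl

/-! ### The lexicographic order and leading monomials of minors -/

/-- The linear order on the variables in which `varLT` is the strict order. -/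
@[reducible] def varOrder (d k₁ k₂ : ℕ) : LinearOrder (Fin d × Col k₁ k₂) :=
  LinearOrder.lift' (fun a => toLex (a.2.2, toLex (a.2.1, a.1))) fun a b h => by
    simp only [EmbeddingLike.apply_eq_iff_eq, Prod.mk.injEq] at h
    exact Prod.ext h.2.2 (Prod.ext h.2.1 h.1)

/-- The lexicographic order `≺` as a `MonomialOrder`. -/
def lexOrder (d k₁ k₂ : ℕ) : MonomialOrder (Fin d × Col k₁ k₂) :=
  @MonomialOrder.lex _ (varOrder d k₁ k₂)
    (@Finite.to_wellFoundedGT _ _ (varOrder d k₁ k₂).toPartialOrder.toPreorder)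

lemma lexOrder_lt_iff {d k₁ k₂ : ℕ} {m m' : (Fin d × Col k₁ k₂) →₀ ℕ} :
    (lexOrder d k₁ k₂).toSyn m < (lexOrder d k₁ k₂).toSyn m' ↔ monLT d k₁ k₂ m m' :=
  Iff.rfl

lemma varLT_iff {d k₁ k₂ : ℕ} {a b : Fin d × Col k₁ k₂} :
    varLT d k₁ k₂ a b ↔
      a.2.2 < b.2.2 ∨ a.2.2 = b.2.2 ∧ (a.2.1 < b.2.1 ∨ a.2.1 = b.2.1 ∧ a.1 < b.1) := by
  simp [varLT, Prod.lex_def]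

lemma isLeadMon_degree {d k₁ k₂ : ℕ} {f : MvP d k₁ k₂} {m : (Fin d × Col k₁ k₂) →₀ ℕ}
    (h : IsLeadMon d k₁ k₂ f m) : (lexOrder d k₁ k₂).degree f = m := by
  have h1 : f ≠ 0 := by
    rintro rfl
    simpa using h.1
  refine (h.2 _ ((lexOrder d k₁ k₂).degree_mem_support h1)).resolve_right fun h2 => ?_
  exact absurd ((lexOrder d k₁ k₂).le_degree h.1) (not_le.2 (lexOrder_lt_iff.2 h2))

/-- The exponent vector of the diagonal term of a minor. -/
def diagMon {d k₁ k₂ r : ℕ} (a : Fin r → Fin d) (b : Fin r → Col k₁ k₂) :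
    (Fin d × Col k₁ k₂) →₀ ℕ :=
  ∑ p, Finsupp.single (a p, b p) 1

lemma diagMon_apply_self {d k₁ k₂ r : ℕ} (a : Fin r → Fin d) {b : Fin r → Col k₁ k₂}
    (hb : Function.Injective b) (x : Fin d) (q : Fin r) :
    diagMon a b (x, b q) = if a q = x then 1 else 0 := by
  simp only [diagMon, Finsupp.coe_finsetSum, Finset.sum_apply, Finsupp.single_apply,
    Prod.mk.injEq]
  rw [Finset.sum_eq_single q]
  · simp
  · intro p _ hpq
    rw [if_neg fun h => hpq (hb h.2)]
  · simp

lemma diagMon_apply_of_notMem {d k₁ k₂ r : ℕ} (a : Fin r → Fin d) {b : Fin r → Col k₁ k₂}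
    (x : Fin d) {c : Col k₁ k₂} (hc : ∀ q, b q ≠ c) : diagMon a b (x, c) = 0 := by
  simp only [diagMon, Finsupp.coe_finsetSum, Finset.sum_apply, Finsupp.single_apply,
    Prod.mk.injEq]
  exact Finset.sum_eq_zero fun p _ => if_neg fun h => hc p h.2

lemma diagMon_le {d k₁ k₂ r : ℕ} {a : Fin r → Fin d} {b : Fin r → Col k₁ k₂}
    (hb : Function.Injective b) {m : (Fin d × Col k₁ k₂) →₀ ℕ} (h : ∀ p, m (a p, b p) ≠ 0) :
    diagMon a b ≤ m := by
  rintro ⟨x, c⟩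
  by_cases hc : ∃ q, b q = c
  · obtain ⟨q, rfl⟩ := hc
    rw [diagMon_apply_self a hb]
    split_ifs with hx
    · exact hx ▸ Nat.one_le_iff_ne_zero.2 (h q)
    · exact Nat.zero_le _
  · rw [diagMon_apply_of_notMem a x fun q hq => hc ⟨q, hq⟩]
    exact Nat.zero_le _

/-- The columns `b` are listed in the order of the columns of `X`. -/
def ColIncreasing {k₁ k₂ r : ℕ} (b : Fin r → Col k₁ k₂) : Prop :=
  ∀ p q, p < q → (b p).2 < (b q).2 ∨ (b p).2 = (b q).2 ∧ (b p).1 < (b q).1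

lemma ColIncreasing.injective {k₁ k₂ r : ℕ} {b : Fin r → Col k₁ k₂} (hb : ColIncreasing b) :
    Function.Injective b := by
  intro p q h
  rcases lt_trichotomy p q with hlt | heq | hlt
  · have := hb p q hlt
    simp [h] at this
  · exact heq
  · have := hb q p hlt
    simp [h] at this

lemma monLT_diagMon_perm {d k₁ k₂ r : ℕ} {a : Fin r → Fin d} {b : Fin r → Col k₁ k₂}
    (ha : StrictMono a) (hb : ColIncreasing b) {σ : Equiv.Perm (Fin r)} (hσ : σ ≠ 1) :
    monLT d k₁ k₂ (diagMon (a ∘ σ) b) (diagMon a b) := by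
  have hbi := hb.injective
  have hex : ∃ p, σ p ≠ p := by
    by_contra! h
    exact hσ (Equiv.ext h)
  obtain ⟨p, hp, hmin⟩ : ∃ p, σ p ≠ p ∧ ∀ q, q < p → σ q = q := by
    obtain ⟨p, hp, h⟩ := WellFounded.has_min (wellFounded_lt (α := Fin r)) {p | σ p ≠ p} hex
    exact ⟨p, hp, fun q hq => by
      by_contra hne
      exact h q hne hq⟩
  have hgt : p < σ p := by
    refine lt_of_le_of_ne (not_lt.1 fun hlt => ?_) hp.symm
    exact hp (σ.injective (hmin _ hlt))
  refine ⟨(a p, b p), ?_, ?_⟩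
  · rintro ⟨x, c⟩ hw
    rw [varLT_iff] at hw
    by_cases hc : ∃ q, b q = c
    · obtain ⟨q, rfl⟩ := hc
      rw [diagMon_apply_self _ hbi, diagMon_apply_self _ hbi]
      rcases lt_trichotomy q p with hq | rfl | hq
      · rw [Function.comp_apply, hmin q hq]
      · have hx : x < a q := by simpa using hw
        have := ha hgt
        rw [Function.comp_apply, if_neg (hx.trans this).ne', if_neg hx.ne']
      · have := hb p q hq
        exfalso
        simp only at hw
        omega
    · rw [diagMon_apply_of_notMem _ x fun q hq => hc ⟨q, hq⟩,
        diagMon_apply_of_notMem _ x fun q hq => hc ⟨q, hq⟩]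
  · rw [diagMon_apply_self _ hbi, diagMon_apply_self _ hbi, if_pos rfl,
      Function.comp_apply, if_neg fun h => hp (ha.injective h)]
    exact Nat.one_pos

lemma minorPoly_eq_sum {d k₁ k₂ r : ℕ} (a : Fin r → Fin d) (b : Fin r → Col k₁ k₂) :
    minorPoly d k₁ k₂ r a b =
      ∑ σ : Equiv.Perm (Fin r),
        monomial (diagMon (a ∘ σ) b) (((Equiv.Perm.sign σ : ℤ) : ℂ)) := by
  rw [minorPoly, Matrix.det_apply']
  refine Finset.sum_congr rfl fun σ _ => ?_
  have h1 : ∏ i, (Matrix.of fun i j => (X (a i, b j) : MvP d k₁ k₂)) (σ i) i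
      = monomial (diagMon (a ∘ σ) b) 1 := by
    rw [diagMon, monomial_sum_one]
    rfl
  have h2 : ((Equiv.Perm.sign σ : ℤ) : MvP d k₁ k₂) = C (((Equiv.Perm.sign σ : ℤ) : ℂ)) := by
    simp
  rw [h1, h2, C_mul_monomial, mul_one]

lemma coeff_diagMon_minorPoly {d k₁ k₂ r : ℕ} {a : Fin r → Fin d} {b : Fin r → Col k₁ k₂}
    (ha : StrictMono a) (hb : ColIncreasing b) :
    coeff (diagMon a b) (minorPoly d k₁ k₂ r a b) = 1 := by
  rw [minorPoly_eq_sum, coeff_sum, Finset.sum_eq_single 1]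
  · simp
  · intro σ _ hσ
    rw [coeff_monomial, if_neg]
    intro h
    obtain ⟨v, -, hv⟩ := monLT_diagMon_perm ha hb hσ
    rw [h] at hv
    exact lt_irrefl _ hv
  · simp

lemma isLeadMon_minorPoly {d k₁ k₂ r : ℕ} {a : Fin r → Fin d} {b : Fin r → Col k₁ k₂}
    (ha : StrictMono a) (hb : ColIncreasing b) :
    IsLeadMon d k₁ k₂ (minorPoly d k₁ k₂ r a b) (diagMon a b) := by
  refine ⟨by simp [mem_support_iff, coeff_diagMon_minorPoly ha hb], fun m' hm' => ?_⟩
  rw [minorPoly_eq_sum] at hm'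
  obtain ⟨σ, -, h⟩ := Finset.mem_biUnion.1 (support_sum hm')
  rw [Finset.mem_singleton.1 (support_monomial_subset h)]
  by_cases hσ : σ = 1
  · subst hσ
    exact Or.inl rfl
  · exact Or.inr (monLT_diagMon_perm ha hb hσ)

lemma leadingCoeff_minorPoly {d k₁ k₂ r : ℕ} {a : Fin r → Fin d} {b : Fin r → Col k₁ k₂}
    (ha : StrictMono a) (hb : ColIncreasing b) :
    (lexOrder d k₁ k₂).leadingCoeff (minorPoly d k₁ k₂ r a b) = 1 := by
  rw [MonomialOrder.leadingCoeff, isLeadMon_degree (isLeadMon_minorPoly ha hb),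
    coeff_diagMon_minorPoly ha hb]

/-- If the only element of `I` all of whose monomials are standard is zero, then some leading
monomial of `G` divides the leading monomial of each nonzero element of `I`. -/
lemma exists_degree_le_of_standard {σ k : Type*} [Field k] (m : MonomialOrder σ)
    {G : Set (MvPolynomial σ k)} {I : Ideal (MvPolynomial σ k)} (hGI : G ⊆ I)
    (hunit : ∀ g ∈ G, IsUnit (m.leadingCoeff g))
    (hstd : ∀ r ∈ I, (∀ c ∈ r.support, ∀ g ∈ G, ¬ m.degree g ≤ c) → r = 0)
    {f : MvPolynomial σ k} (hf : f ∈ I) (hf0 : f ≠ 0) : ∃ g ∈ G, m.degree g ≤ m.degree f := by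
  obtain ⟨q, r, hfr, hdeg, hr⟩ := m.div_set hunit f
  have hqI : Finsupp.linearCombination _ (fun b : G => (b : MvPolynomial σ k)) q ∈ I := by
    rw [Finsupp.linearCombination_apply]
    exact Submodule.sum_mem _ fun b _ => I.mul_mem_left _ (hGI b.2)
  have hr0 : r = 0 := hstd r (by
    have : r = f - Finsupp.linearCombination _ (fun b : G => (b : MvPolynomial σ k)) q :=
      eq_sub_of_add_eq' hfr.symm
    exact this ▸ I.sub_mem hf hqI) hr
  have hsum : f = q.sum fun b c => c * (b : MvPolynomial σ k) := by
    rw [hr0, add_zero, Finsupp.linearCombination_apply] at hfr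
    exact hfr
  have hmem : m.degree f ∈ (q.sum fun b c => c * (b : MvPolynomial σ k)).support := by
    rw [← hsum]
    exact m.degree_mem_support hf0
  classical
  obtain ⟨b, -, hb⟩ := Finset.mem_biUnion.1 (support_sum hmem)
  have hne : q b * (b : MvPolynomial σ k) ≠ 0 := by
    intro h0
    simp [h0] at hb
  have hdegb : m.degree (q b * (b : MvPolynomial σ k)) = m.degree f := by
    refine m.toSyn.injective (le_antisymm ?_ (m.le_degree hb))
    rw [mul_comm]
    exact hdeg b
  refine ⟨b, b.2, ?_⟩
  rw [← hdegb, m.degree_mul (left_ne_zero_of_mul hne) (right_ne_zero_of_mul hne)]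
  exact le_add_self

/-! ### Uniqueness of standard monomials with given marginals -/

lemma exists_lt_of_sum_eq {ι : Type*} [Fintype ι] {u u' : ι → ℕ} (h : ∑ x, u x = ∑ x, u' x)
    {x : ι} (hx : u x < u' x) : ∃ y, u' y < u y := by
  by_contra! hle
  exact absurd h (Finset.sum_lt_sum (fun y _ => hle y) ⟨x, Finset.mem_univ x, hx⟩).ne

lemma le_of_margins {α β : Type*} [Fintype α] [Fintype β] [LinearOrder α] [LinearOrder β]
    {u u' : α → β → ℕ}
    (hu' : ∀ i i' j j', i < i' → j < j' → u' i j = 0 ∨ u' i' j' = 0)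
    (hcol : ∀ j, ∑ i, u i j = ∑ i, u' i j) (hrow : ∀ i, ∑ j, u i j = ∑ j, u' i j)
    {i : α} {j : β} (h1 : ∀ j₀ < j, ∀ i₀, u i₀ j₀ = u' i₀ j₀) (h2 : ∀ i₀ < i, u i₀ j = u' i₀ j) :
    u' i j ≤ u i j := by
  by_contra! hlt
  obtain ⟨i', hi'⟩ := exists_lt_of_sum_eq (hcol j) hlt
  obtain ⟨j', hj'⟩ := exists_lt_of_sum_eq (hrow i').symm hi'
  have hii : i < i' := by
    rcases lt_trichotomy i i' with h | rfl | h
    · exact h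
    · omega
    · have := h2 i' h
      omega
  have hjj : j < j' := by
    rcases lt_trichotomy j j' with h | rfl | h
    · exact h
    · omega
    · have := h1 j' h i'
      omega
  have := hu' i i' j j' hii hjj
  omega

/-- A matrix of naturals with no two nonzero entries in diagonal position is determined by its
row and column sums. -/
lemma eq_of_margins {α β : Type*} [Fintype α] [Fintype β] [LinearOrder α] [LinearOrder β]
    {u u' : α → β → ℕ}
    (hu : ∀ i i' j j', i < i' → j < j' → u i j = 0 ∨ u i' j' = 0)
    (hu' : ∀ i i' j j', i < i' → j < j' → u' i j = 0 ∨ u' i' j' = 0)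
    (hcol : ∀ j, ∑ i, u i j = ∑ i, u' i j) (hrow : ∀ i, ∑ j, u i j = ∑ j, u' i j) (j : β) :
    ∀ i, u i j = u' i j := by
  induction j using WellFoundedLT.induction with
  | ind j ihj =>
    intro i
    induction i using WellFoundedLT.induction with
    | ind i ihi =>
      exact le_antisymm
        (le_of_margins hu (fun j => (hcol j).symm) (fun i => (hrow i).symm)
          (fun j₀ h i₀ => (ihj j₀ h i₀).symm) fun i₀ h => (ihi i₀ h).symm)
        (le_of_margins hu' hcol hrow ihj ihi)

/-! ### The parametrization -/

/-- The position of a variable after identifying the columns of each slice `C_ℓ`. -/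
def blockPos {d k₁ k₂ : ℕ} (p : Fin d × Col k₁ k₂) : ℕ × ℕ := (p.1.1, p.2.2.1)

/-- The matrix whose column `(j, ℓ)` is `a (j, ℓ)` times column `ℓ` of `Y`. -/
def blockPoint {d k₁ k₂ : ℕ} (Y : ℕ × ℕ → ℂ) (a : Col k₁ k₂ → ℂ) : Fin d × Col k₁ k₂ → ℂ :=
  fun p => Y (blockPos p) * a p.2

lemma eval_blockPoint_monomial {d k₁ k₂ : ℕ} (Y : ℕ × ℕ → ℂ) (a : Col k₁ k₂ → ℂ)
    (m : (Fin d × Col k₁ k₂) →₀ ℕ) (c : ℂ) :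
    eval (blockPoint Y a) (monomial m c) =
      eval a (monomial (m.mapDomain Prod.snd) (eval Y (monomial (m.mapDomain blockPos) c))) := by
  simp only [eval_monomial]
  rw [Finsupp.prod_mapDomain_index (fun _ => pow_zero _) fun _ _ _ => pow_add _ _ _,
    Finsupp.prod_mapDomain_index (fun _ => pow_zero _) fun _ _ _ => pow_add _ _ _, mul_assoc,
    ← Finsupp.prod_mul]
  simp only [blockPoint, mul_pow]

lemma mapDomain_snd_apply {d k₁ k₂ : ℕ} (m : (Fin d × Col k₁ k₂) →₀ ℕ) (c : Col k₁ k₂) :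
    m.mapDomain Prod.snd c = ∑ i, m (i, c) := by
  rw [Finsupp.mapDomain, Finsupp.sum_fintype _ _ (by simp), Finsupp.coe_finsetSum,
    Finset.sum_apply, Fintype.sum_prod_type]
  refine Finset.sum_congr rfl fun i _ => ?_
  rw [Finset.sum_eq_single c] <;> simp +contextual

lemma mapDomain_blockPos_apply {d k₁ k₂ : ℕ} (m : (Fin d × Col k₁ k₂) →₀ ℕ) (i : Fin d)
    (l : Fin k₂) : m.mapDomain blockPos (i.1, l.1) = ∑ j, m (i, (j, l)) := by
  rw [Finsupp.mapDomain, Finsupp.sum_fintype _ _ (by simp), Finsupp.coe_finsetSum,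
    Finset.sum_apply, Fintype.sum_prod_type, Finset.sum_eq_single i]
  · rw [Fintype.sum_prod_type]
    refine Finset.sum_congr rfl fun j _ => ?_
    rw [Finset.sum_eq_single l] <;>
      simp +contextual [blockPos, Fin.val_inj]
  · intro i' _ hi'
    refine Finset.sum_eq_zero fun c _ => ?_
    simp [blockPos, Fin.val_inj, hi']
  · simp

lemma eval_minorPoly {d k₁ k₂ r : ℕ} (x : Fin d × Col k₁ k₂ → ℂ) (a : Fin r → Fin d)
    (b : Fin r → Col k₁ k₂) :
    eval x (minorPoly d k₁ k₂ r a b) = (Matrix.of fun i j => x (a i, b j)).det := by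
  rw [minorPoly, RingHom.map_det]
  congr 1
  ext i j
  simp

lemma eval_blockPoint_minorPoly_eq_zero {d k₁ k₂ r : ℕ} {Y : ℕ × ℕ → ℂ}
    (hY : tailRank d k₂ 0 Y 0 < r) (z : Col k₁ k₂ → ℂ) (a : Fin r → Fin d)
    (b : Fin r → Col k₁ k₂) : eval (blockPoint Y z) (minorPoly d k₁ k₂ r a b) = 0 := by
  rw [eval_minorPoly]
  by_contra hdet
  have hli := Matrix.linearIndependent_cols_of_det_ne_zero hdet
  have hsub : Submodule.span ℂ (Set.range
      (Matrix.of fun i j => blockPoint (d := d) Y z (a i, b j)).col)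
      ≤ (tailSpan d k₂ 0 Y 0).map (LinearMap.funLeft ℂ ℂ a) := by
    rw [Submodule.span_le]
    rintro _ ⟨j, rfl⟩
    refine ⟨z (b j) • truncCol d 0 Y (b j).2.1, Submodule.smul_mem _ _
      (truncCol_mem_tailSpan (Nat.zero_le _) (b j).2.2), ?_⟩
    ext i
    simp [truncCol, blockPoint, blockPos, LinearMap.funLeft_apply, mul_comm]
  have h1 := finrank_span_eq_card hli
  have h2 := (Submodule.finrank_mono hsub).trans (Submodule.finrank_map_le _ _)
  rw [h1, Fintype.card_fin] at h2
  exact absurd hY (not_lt.2 h2)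

lemma eval_blockPoint_eq_zero {d k₁ k₂ t : ℕ} {Y : ℕ × ℕ → ℂ} (hY : tailRank d k₂ 0 Y 0 < t)
    (z : Col k₁ k₂ → ℂ) {f : MvP d k₁ k₂} (hf : f ∈ Iempty d k₁ k₂ t) :
    eval (blockPoint Y z) f = 0 := by
  have hle : Iempty d k₁ k₂ t ≤ RingHom.ker (eval (blockPoint (d := d) Y z)) := by
    refine sup_le (Ideal.span_le.2 ?_) (iSup_le fun l => Ideal.span_le.2 ?_)
    · rintro _ ⟨a, b, -, -, -, rfl⟩
      exact eval_blockPoint_minorPoly_eq_zero hY z a b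
    · rintro _ ⟨a, b, -, -, hb, rfl⟩
      have h0 : (b 0).2 = l := hb 0
      have h1 : (b 1).2 = l := hb 1
      rw [SetLike.mem_coe, RingHom.mem_ker, eval_minorPoly, Matrix.det_fin_two]
      simp only [Matrix.of_apply, blockPoint, blockPos, h0, h1]
      ring
  exact hle hf

/-- The minors of `F_∅` with rows and columns listed increasingly. -/
def sortedMinors (d k₁ k₂ t : ℕ) : Set (MvP d k₁ k₂) :=
  {f | ∃ a : Fin t → Fin d, ∃ b : Fin t → Col k₁ k₂, StrictMono a ∧ ColIncreasing b ∧
    f = minorPoly d k₁ k₂ t a b} ∪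
  {f | ∃ a : Fin 2 → Fin d, ∃ b : Fin 2 → Col k₁ k₂, StrictMono a ∧ ColIncreasing b ∧
    (∃ l, ∀ i, (b i).2 = l) ∧ f = minorPoly d k₁ k₂ 2 a b}

lemma sortedMinors_subset (d k₁ k₂ t : ℕ) :
    sortedMinors d k₁ k₂ t ⊆
      minorSet d k₁ k₂ t Set.univ ∪ ⋃ j : Fin k₂, minorSet d k₁ k₂ 2 (colSlice k₁ k₂ j) := by
  rintro f (⟨a, b, ha, hb, rfl⟩ | ⟨a, b, ha, hb, ⟨l, hl⟩, rfl⟩)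
  · exact Or.inl ⟨a, b, ha.injective, hb.injective, fun _ => trivial, rfl⟩
  · exact Or.inr (Set.mem_iUnion.2 ⟨l, a, b, ha.injective, hb.injective, hl, rfl⟩)

lemma subset_Iempty (d k₁ k₂ t : ℕ) :
    minorSet d k₁ k₂ t Set.univ ∪ ⋃ j : Fin k₂, minorSet d k₁ k₂ 2 (colSlice k₁ k₂ j) ⊆
      (Iempty d k₁ k₂ t : Set (MvP d k₁ k₂)) := by
  refine Set.union_subset ?_ (Set.iUnion_subset fun j => ?_)
  · exact fun f hf => Ideal.mem_sup_left (Ideal.subset_span hf)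
  · exact fun f hf => Ideal.mem_sup_right (Ideal.mem_iSup_of_mem j (Ideal.subset_span hf))

lemma exists_isLeadMon_of_mem_sortedMinors {d k₁ k₂ t : ℕ} {g : MvP d k₁ k₂}
    (hg : g ∈ sortedMinors d k₁ k₂ t) :
    (∃ m, IsLeadMon d k₁ k₂ g m) ∧ (lexOrder d k₁ k₂).leadingCoeff g = 1 := by
  rcases hg with ⟨a, b, ha, hb, rfl⟩ | ⟨a, b, ha, hb, -, rfl⟩
  all_goals exact ⟨⟨_, isLeadMon_minorPoly ha hb⟩, leadingCoeff_minorPoly ha hb⟩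

section Standard

variable {d k₁ k₂ t : ℕ} {m : (Fin d × Col k₁ k₂) →₀ ℕ}

lemma block_standard (hm : ∀ g ∈ sortedMinors d k₁ k₂ t, ¬ (lexOrder d k₁ k₂).degree g ≤ m)
    (l : Fin k₂) (i i' : Fin d) (j j' : Fin k₁) (hi : i < i') (hj : j < j') :
    m (i, (j, l)) = 0 ∨ m (i', (j', l)) = 0 := by
  by_contra! h
  have ha : StrictMono ![i, i'] := by simpa using hi
  have hb : ColIncreasing ![(j, l), (j', l)] := by
    intro p q hpq
    fin_cases p <;> fin_cases q <;> simp_all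
  refine hm (minorPoly d k₁ k₂ 2 ![i, i'] ![(j, l), (j', l)])
    (Or.inr ⟨_, _, ha, hb, ⟨l, fun p => by fin_cases p <;> rfl⟩, rfl⟩) ?_
  rw [isLeadMon_degree (isLeadMon_minorPoly ha hb)]
  refine diagMon_le hb.injective fun p => ?_
  fin_cases p
  · exact h.1
  · exact h.2

lemma exists_of_mem_support_blockPos {i l : ℕ} (h : (i, l) ∈ (m.mapDomain blockPos).support) :
    ∃ (i' : Fin d) (j : Fin k₁) (l' : Fin k₂), i'.1 = i ∧ l'.1 = l ∧ m (i', (j, l')) ≠ 0 := by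
  classical
  obtain ⟨⟨i', j, l'⟩, h1, h2⟩ := Finset.mem_image.1 (Finsupp.mapDomain_support h)
  simp only [blockPos, Prod.mk.injEq] at h2
  exact ⟨i', j, l', h2.1, h2.2, Finsupp.mem_support_iff.1 h1⟩

lemma not_hasChain (hm : ∀ g ∈ sortedMinors d k₁ k₂ t, ¬ (lexOrder d k₁ k₂).degree g ≤ m)
    (i j : ℕ) : ¬ HasChain (m.mapDomain blockPos).support t i j := by
  intro h
  obtain ⟨u, v, hu, hv, huv⟩ := h.exists_strictMono
  choose a b c ha hc habc using fun p => exists_of_mem_support_blockPos (huv p).2.2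
  have ha' : StrictMono a := fun p q hpq => Fin.lt_def.2 (by rw [ha, ha]; exact hu hpq)
  have hb : ColIncreasing fun p => (b p, c p) := fun p q hpq =>
    Or.inl (Fin.lt_def.2 (by rw [hc, hc]; exact hv hpq))
  refine hm _ (Or.inl ⟨a, fun p => (b p, c p), ha', hb, rfl⟩) ?_
  rw [isLeadMon_degree (isLeadMon_minorPoly ha' hb)]
  exact diagMon_le hb.injective habc

lemma isStdFrom_mapDomain (ht : 0 < t)
    (hm : ∀ g ∈ sortedMinors d k₁ k₂ t, ¬ (lexOrder d k₁ k₂).degree g ≤ m) :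
    IsStdFrom d k₂ 0 0 (fun _ => t - 1) (fun _ => t - 1) (m.mapDomain blockPos) := by
  have hchain : ∀ k i j, HasChain (m.mapDomain blockPos).support k i j → k ≤ t - 1 := by
    intro k i j h
    by_contra! hk
    exact not_hasChain hm i j (h.of_le (by omega))
  refine ⟨?_, fun k j h => hchain k _ j h, fun k j _ h => hchain k _ j h⟩
  rintro ⟨i, l⟩ h
  obtain ⟨i', j, l', rfl, rfl, -⟩ := exists_of_mem_support_blockPos h
  exact ⟨i'.2, l'.2, by simp only [Nat.zero_le, and_true]; omega⟩

lemma standard_ext {m' : (Fin d × Col k₁ k₂) →₀ ℕ}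
    (hm : ∀ g ∈ sortedMinors d k₁ k₂ t, ¬ (lexOrder d k₁ k₂).degree g ≤ m)
    (hm' : ∀ g ∈ sortedMinors d k₁ k₂ t, ¬ (lexOrder d k₁ k₂).degree g ≤ m')
    (h1 : m.mapDomain Prod.snd = m'.mapDomain Prod.snd)
    (h2 : m.mapDomain blockPos = m'.mapDomain blockPos) : m = m' := by
  ext ⟨i, j, l⟩
  refine eq_of_margins (u := fun i j => m (i, (j, l))) (u' := fun i j => m' (i, (j, l)))
    (block_standard hm l) (block_standard hm' l) (fun j => ?_) (fun i => ?_) j i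
  · rw [← mapDomain_snd_apply, ← mapDomain_snd_apply, h1]
  · rw [← mapDomain_blockPos_apply, ← mapDomain_blockPos_apply, h2]

end Standard

/-- The standard monomials are linearly independent modulo `I_∅`. -/
lemma eq_zero_of_mem_Iempty_of_standard {d k₁ k₂ t : ℕ} (ht : 0 < t) {f : MvP d k₁ k₂}
    (hf : f ∈ Iempty d k₁ k₂ t)
    (hstd : ∀ m ∈ f.support, ∀ g ∈ sortedMinors d k₁ k₂ t,
      ¬ (lexOrder d k₁ k₂).degree g ≤ m) : f = 0 := by
  classical
  by_contra hne
  obtain ⟨m₀, hm₀⟩ : f.support.Nonempty := by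
    rwa [Finset.nonempty_iff_ne_empty, Ne, MvPolynomial.support_eq_empty]
  set g : MvPolynomial (ℕ × ℕ) ℂ :=
    ∑ m ∈ f.support with m.mapDomain Prod.snd = m₀.mapDomain Prod.snd,
      monomial (m.mapDomain blockPos) (coeff m f) with hg
  have hg0 : g = 0 := by
    refine stdIndep_of_antitone d k₂ d 0 (by omega) (fun _ => t - 1) antitone_const g
      (fun β hβ => ?_) fun Y hY => ?_
    · obtain ⟨m, hm, h⟩ := Finset.mem_biUnion.1 (support_sum hβ)
      rw [Finset.mem_singleton.1 (support_monomial_subset h)]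
      exact isStdFrom_mapDomain ht (hstd m (Finset.mem_filter.1 hm).1)
    · have hrank : tailRank d k₂ 0 Y 0 < t := by
        have : tailRank d k₂ 0 Y 0 ≤ t - 1 := hY.2 0 le_rfl
        omega
      have hP : ∑ m ∈ f.support, monomial (m.mapDomain (Prod.snd : _ → Col k₁ k₂))
          (eval Y (monomial (m.mapDomain blockPos) (coeff m f))) = 0 := by
        refine MvPolynomial.funext fun z => ?_
        rw [map_zero, map_sum, ← eval_blockPoint_eq_zero hrank z hf]
        conv_rhs => rw [f.as_sum, map_sum]
        exact Finset.sum_congr rfl fun m _ => (eval_blockPoint_monomial Y z m _).symm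
      have hc := congrArg (coeff (m₀.mapDomain Prod.snd)) hP
      rw [coeff_sum, coeff_zero] at hc
      refine Eq.trans ?_ hc
      rw [hg, map_sum, Finset.sum_filter]
      exact Finset.sum_congr rfl fun m _ => by rw [coeff_monomial]
  have hc : coeff (m₀.mapDomain blockPos) g = coeff m₀ f := by
    rw [hg, coeff_sum, Finset.sum_eq_single m₀]
    · simp
    · intro m hm hmm
      rw [coeff_monomial, if_neg]
      intro h
      have hm' := Finset.mem_filter.1 hm
      exact hmm (standard_ext (hstd m hm'.1) (hstd m₀ hm₀) hm'.2 h)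
    · intro h
      exact (h (Finset.mem_filter.2 ⟨hm₀, rfl⟩)).elim
  rw [hg0, coeff_zero] at hc
  exact mem_support_iff.1 hm₀ hc.symm

/-- for `2 ≤ k₁` and `2 ≤ t ≤ min(k₂, d)`, the set
`F_∅ = F_t(X) ∪ ⋃_j F_2(X_{C_j})` is a Gröbner basis of
`I_∅ = I_t(X) + Σ_j I_2(X_{C_j})` with respect to the lexicographic order `≺`. -/
theorem Fempty_isGB
    (d k₁ k₂ t : ℕ) (hk₁ : 2 ≤ k₁) (ht : 2 ≤ t) (htk : t ≤ k₂) (htd : t ≤ d) :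
    IsGB d k₁ k₂
      (minorSet d k₁ k₂ t Set.univ ∪
        ⋃ j : Fin k₂, minorSet d k₁ k₂ 2 (colSlice k₁ k₂ j))
      (Iempty d k₁ k₂ t) := by
  refine ⟨subset_Iempty d k₁ k₂ t, fun f hf hf0 => ?_⟩
  obtain ⟨g, hg, hle⟩ := exists_degree_le_of_standard (lexOrder d k₁ k₂)
    ((sortedMinors_subset d k₁ k₂ t).trans (subset_Iempty d k₁ k₂ t))
    (fun g hg => (exists_isLeadMon_of_mem_sortedMinors hg).2 ▸ isUnit_one)
    (fun r hr hstd => eq_zero_of_mem_Iempty_of_standard (by omega) hr hstd) hf hf0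
  obtain ⟨m, hm⟩ := (exists_isLeadMon_of_mem_sortedMinors hg).1
  refine ⟨g, sortedMinors_subset d k₁ k₂ t hg, m, hm, fun mf hmf => ?_⟩
  rw [isLeadMon_degree hm, isLeadMon_degree hmf] at hle
  exact hle

end CI
end
end
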